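/- arXiv:2502.07285 — 2 statements merged into one kernel-verified Lean document; each statement's English description precedes it below -/
import Mathlib

section
/- There exists a universal constant A > 0 with the following property. Let S be a determinantal point process on a finite set X = {1,...,N} with a Hermitian kernel matrix K, and let f: X → ℝ be a bounded function with linear statistic Λ_S(f) = Σ_{x∈S} f(x). Then for all a satisfying 0 ≤ a ≤ 2 A Var[Λ_S(f)] / (3 ‖f‖_∞), P( |Λ_S(f) − E[Λ_S(f)]| ≥ a ) ≤ 2 exp( − a² / (4 A Var[Λ_S(f)]) ), where ‖f‖_∞ = max_{x∈X} |f(x)|. -/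
open scoped Classical

/-- `μ` is the law of a determinantal point process on `Fin N` with kernel `K`. -/
def IsDPPLaw {N : ℕ} (μ : Finset (Fin N) → ℝ) (K : Matrix (Fin N) (Fin N) ℂ) : Prop :=
  (∀ A, 0 ≤ μ A) ∧ (∑ A : Finset (Fin N), μ A) = 1 ∧
    ∀ A : Finset (Fin N),
      ((∑ S ∈ Finset.univ.filter (fun S => A ⊆ S), μ S : ℝ) : ℂ)
        = (K.submatrix (fun i : A => (i : Fin N)) (fun j : A => (j : Fin N))).det

/-- Mean of the linear statistic `Λ_S(f) = ∑_{x ∈ S} f x` under the law `μ`. -/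
noncomputable def dppMean {N : ℕ} (μ : Finset (Fin N) → ℝ) (f : Fin N → ℝ) : ℝ :=
  ∑ A : Finset (Fin N), μ A * ∑ x ∈ A, f x

/-- Variance of the linear statistic `Λ_S(f)` under the law `μ`. -/
noncomputable def dppVar {N : ℕ} (μ : Finset (Fin N) → ℝ) (f : Fin N → ℝ) : ℝ :=
  ∑ A : Finset (Fin N), μ A * ((∑ x ∈ A, f x) - dppMean μ f) ^ 2

section

open Matrix
open scoped ComplexOrder

/-- The determinant of `1 + M` is the sum of the principal minors of `M`. -/
theorem Matrix.det_one_add_eq_sum_minors {n R : Type*} [Fintype n] [DecidableEq n] [CommRing R]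
    (M : Matrix n n R) :
    (1 + M).det = ∑ s : Finset n, (M.submatrix (fun i : s => (i : n)) (fun j : s => (j : n))).det := by
  have h : (M + 1).det = ∑ s : Finset n,
      (Matrix.of <| s.piecewise M.row (1 : Matrix n n R).row).det :=
    (Matrix.detRowAlternating (n := n) (R := R)).map_add_univ M.row (1 : Matrix n n R).row
  rw [add_comm, h]
  exact Finset.sum_congr rfl fun s _ => Matrix.det_piecewise_one_eq_submatrix_det M s

open scoped MatrixOrder Matrix.Norms.L2Operator in
/-- The trace of a product of two positive semidefinite matrices is nonnegative. -/
theorem Matrix.PosSemidef.re_trace_mul_nonneg {n : Type*} [Fintype n] {A B : Matrix n n ℂ}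
    (hA : A.PosSemidef) (hB : B.PosSemidef) : 0 ≤ (A * B).trace.re := by
  obtain ⟨C, rfl⟩ := CStarAlgebra.nonneg_iff_eq_star_mul_self.mp hB.nonneg
  rw [Matrix.star_eq_conjTranspose, ← Matrix.mul_assoc, Matrix.trace_mul_comm, ← Matrix.mul_assoc]
  exact (Complex.le_def.mp (hA.mul_mul_conjTranspose_same C).trace_nonneg).1

namespace IsDPPLaw

variable {N : ℕ} {μ : Finset (Fin N) → ℝ} {K : Matrix (Fin N) (Fin N) ℂ}

/-- The multivariate generating function of a DPP. -/
theorem sum_mul_prod_eq_det (h : IsDPPLaw μ K) (g : Fin N → ℂ) :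
    ∑ S, (μ S : ℂ) * ∏ x ∈ S, g x = (1 + (diagonal g - 1) * K).det := by
  have key (S : Finset (Fin N)) :
      ∏ x ∈ S, g x = ∑ A : Finset (Fin N), if A ⊆ S then ∏ x ∈ A, (g x - 1) else 0 := by
    rw [← Finset.sum_filter, Finset.filter_subset_univ, ← Finset.prod_one_add]
    simp
  rw [Matrix.det_one_add_eq_sum_minors]
  simp_rw [key, Finset.mul_sum]
  rw [Finset.sum_comm]
  refine Finset.sum_congr rfl fun A _ => ?_
  have hminor : ((diagonal g - 1) * K).submatrix (fun i : A => (i : Fin N))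
      (fun j : A => (j : Fin N)) =
      diagonal (fun i : A => g i - 1) *
        K.submatrix (fun i : A => (i : Fin N)) (fun j : A => (j : Fin N)) := by
    ext i j
    simp [← Matrix.diagonal_one, Matrix.diagonal_sub, Matrix.diagonal_mul]
  rw [hminor, Matrix.det_mul, Matrix.det_diagonal, ← h.2.2 A, Finset.prod_coe_sort A (fun i => g i - 1)]
  push_cast
  rw [Finset.sum_filter, Finset.mul_sum]
  refine Finset.sum_congr rfl fun S _ => ?_
  split_ifs <;> ring

theorem sum_mul_pos (h : IsDPPLaw μ K) {g : Finset (Fin N) → ℝ} (hg : ∀ S, 0 < g S) :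
    0 < ∑ S, μ S * g S := by
  refine (Finset.sum_nonneg fun S _ => mul_nonneg (h.1 S) (hg S).le).lt_of_ne' fun h0 => ?_
  rw [Finset.sum_eq_zero_iff_of_nonneg fun S _ => mul_nonneg (h.1 S) (hg S).le] at h0
  have : ∑ S, μ S = 0 := Finset.sum_eq_zero fun S hS =>
    (mul_eq_zero.mp (h0 S hS)).resolve_right (hg S).ne'
  linarith [h.2.1]

/-- The real eigenvalues of the kernel of a DPP lie in `[0, 1]`. -/
theorem eigenvalue_mem_Icc (h : IsDPPLaw μ K) {k : ℝ} {v : Fin N → ℂ} (hv : v ≠ 0)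
    (hk : K *ᵥ v = (k : ℂ) • v) : k ∈ Set.Icc 0 1 := by
  by_contra hmem
  have hk0 : k ≠ 0 := by
    rintro rfl
    exact hmem ⟨le_rfl, zero_le_one⟩
  have hpos : 0 < 1 - 1 / k := by
    rcases lt_or_gt_of_ne hk0 with hneg | hpos
    · have := one_div_neg.mpr hneg
      linarith
    · have : 1 < k := by
        by_contra hle
        exact hmem ⟨hpos.le, not_lt.mp hle⟩
      rw [sub_pos, div_lt_one hpos]
      exact this
  have hdet : (1 + (diagonal (fun _ => ((1 - 1 / k : ℝ) : ℂ)) - 1) * K).det = 0 := by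
    refine Matrix.exists_mulVec_eq_zero_iff.mp ⟨v, hv, ?_⟩
    have hdiag : (diagonal (fun _ => ((1 - 1 / k : ℝ) : ℂ)) - 1 : Matrix (Fin N) (Fin N) ℂ) =
        (-(1 / k : ℂ)) • 1 := by
      rw [← Matrix.diagonal_one, Matrix.diagonal_sub, ← Matrix.diagonal_smul]
      congr 1
      ext
      simp
    rw [hdiag, Matrix.add_mulVec, Matrix.one_mulVec, Matrix.smul_mul, Matrix.one_mul,
      Matrix.smul_mulVec, hk, smul_smul]
    have : (k : ℂ) ≠ 0 := by exact_mod_cast hk0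
    have h1 : -(1 / k : ℂ) * k = -1 := by field_simp
    rw [h1]
    simp
  rw [← h.sum_mul_prod_eq_det] at hdet
  have := h.sum_mul_pos (g := fun S => ∏ _x ∈ S, (1 - 1 / k)) fun S => Finset.prod_pos fun _ _ => hpos
  have h2 : ((∑ S, μ S * ∏ _x ∈ S, (1 - 1 / k) : ℝ) : ℂ) = 0 := by
    rw [← hdet]
    push_cast
    rfl
  exact this.ne' (by exact_mod_cast h2)

theorem posSemidef (h : IsDPPLaw μ K) (hK : K.IsHermitian) : K.PosSemidef := by
  rw [hK.posSemidef_iff_eigenvalues_nonneg]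
  intro i
  refine (h.eigenvalue_mem_Icc (v := ⇑(hK.eigenvectorBasis i)) ?_ ?_).1
  · have := hK.eigenvectorBasis.orthonormal.ne_zero i
    exact fun h0 => this (by ext j; exact congrFun h0 j)
  · simpa using! hK.mulVec_eigenvectorBasis i

theorem posSemidef_one_sub (h : IsDPPLaw μ K) (hK : K.IsHermitian) : (1 - K).PosSemidef := by
  have hK' : (1 - K).IsHermitian := Matrix.isHermitian_one.sub hK
  rw [hK'.posSemidef_iff_eigenvalues_nonneg]
  intro i
  have hv := hK'.mulVec_eigenvectorBasis i
  have := (h.eigenvalue_mem_Icc (k := 1 - hK'.eigenvalues i)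
    (v := ⇑(hK'.eigenvectorBasis i)) ?_ ?_).2
  · simpa using this
  · have := hK'.eigenvectorBasis.orthonormal.ne_zero i
    exact fun h0 => this (by ext j; exact congrFun h0 j)
  · rw [Matrix.sub_mulVec, Matrix.one_mulVec] at hv
    rw [sub_eq_iff_eq_add, ← sub_eq_iff_eq_add'] at hv
    rw [← hv]
    ext j
    simp [sub_mul]

end IsDPPLaw

section Contraction

variable {n : Type*} [Fintype n] [DecidableEq n] {P F : Matrix n n ℂ} {M : ℝ}

theorem Matrix.PosSemidef.mul_one_sub_self (hP : P.PosSemidef) (hQ : (1 - P).PosSemidef) :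
    (P * (1 - P)).PosSemidef := by
  have h1 := hQ.mul_mul_conjTranspose_same P
  have h2 := hP.mul_mul_conjTranspose_same (1 - P)
  rw [hP.1.eq] at h1
  rw [hQ.1.eq] at h2
  convert h1.add h2 using 1
  noncomm_ring

/-- The trace form of the variance of the linear statistic of the process with kernel `P`. -/
noncomputable def Matrix.varianceForm (F P : Matrix n n ℂ) : ℝ :=
  (F * F * P - F * P * F * P).trace.re

theorem Matrix.varianceForm_nonneg (hP : P.PosSemidef) (hQ : (1 - P).PosSemidef)
    (hF : F.IsHermitian) : 0 ≤ varianceForm F P := by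
  have h1 := hQ.mul_mul_conjTranspose_same F
  rw [hF.eq] at h1
  convert h1.re_trace_mul_nonneg hP using 1
  rw [varianceForm]
  congr 2
  noncomm_ring

/-- The third cumulant of a linear statistic is controlled by its variance. -/
theorem Matrix.third_cumulant_le (hP : P.PosSemidef) (hQ : (1 - P).PosSemidef)
    (hF : F.IsHermitian) (hM : 0 ≤ M) (hadd : ((M : ℂ) • 1 + F).PosSemidef)
    (hsub : ((M : ℂ) • 1 - F).PosSemidef) {D : Matrix n n ℂ}
    (hD : D = (1 / 2 : ℂ) • (F * P + P * F) - P * F * P) :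
    (F * F * D - (F * D * F * P + F * P * F * D)).trace.re ≤ 2 * M * varianceForm F P := by
  have hMc : (0 : ℂ) ≤ (M : ℂ) := by exact_mod_cast hM
  have hPQ := (hP.mul_one_sub_self hQ).smul hMc
  have hFPF := hP.mul_mul_conjTranspose_same F
  have hFQF := hQ.mul_mul_conjTranspose_same F
  have hR1 := (hsub.mul_mul_conjTranspose_same (1 - P)).add hPQ
  have hR2 := (hadd.mul_mul_conjTranspose_same P).add hPQ
  rw [hF.eq] at hFPF hFQF
  rw [hQ.1.eq] at hR1
  rw [hP.1.eq] at hR2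
  have h1 := hFPF.re_trace_mul_nonneg hR1
  have h2 := hFQF.re_trace_mul_nonneg hR2
  rw [varianceForm]
  have key : (2 * M : ℂ) * (F * F * P - F * P * F * P).trace -
      (F * F * D - (F * D * F * P + F * P * F * D)).trace =
      (F * P * F * ((1 - P) * ((M : ℂ) • 1 - F) * (1 - P) + (M : ℂ) • (P * (1 - P)))).trace +
      (F * (1 - P) * F * (P * ((M : ℂ) • 1 + F) * P + (M : ℂ) • (P * (1 - P)))).trace := by
    subst hD
    simp only [mul_add, add_mul, mul_sub, sub_mul, mul_assoc, trace_add, trace_sub, trace_smul,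
      smul_eq_mul, mul_one, one_mul, Matrix.mul_smul, Matrix.smul_mul, smul_add, smul_sub]
    have c1 := trace_mul_comm (F * (F * P)) F
    have c2 := trace_mul_comm (F * P) (F * (F * P))
    have c3 := trace_mul_comm (F * (P * (F * P))) F
    have c4 := trace_mul_comm (F * P) F
    have c5 := trace_mul_comm (F * P) (F * F)
    simp only [mul_assoc] at c1 c2 c3 c4 c5
    rw [c1, c2, c3, c4, c5]
    ring
  have := congrArg Complex.re key
  simp only [Complex.sub_re, Complex.add_re, Complex.mul_re, Complex.ofReal_re, Complex.ofReal_im,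
    Complex.re_ofNat, Complex.im_ofNat, Complex.mul_im] at this
  linarith

end Contraction

section Tilt

open scoped Matrix.Norms.Operator

variable {n : Type*} [Fintype n] [DecidableEq n]

/-- The diagonal matrix `exp (t f / 2)`. -/
noncomputable def halfTilt (f : n → ℝ) (t : ℝ) : Matrix n n ℂ :=
  diagonal fun x => (Real.exp (t * f x / 2) : ℂ)

/-- The matrix whose determinant is the Laplace transform of a linear statistic. -/
noncomputable def tiltDenom (K : Matrix n n ℂ) (f : n → ℝ) (t : ℝ) : Matrix n n ℂ :=
  1 + (halfTilt f t * halfTilt f t - 1) * K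

/-- The kernel of the process with kernel `K`, reweighted by `exp (t Λ(f))`. -/
noncomputable def tiltKernel (K : Matrix n n ℂ) (f : n → ℝ) (t : ℝ) : Matrix n n ℂ :=
  halfTilt f t * K * (tiltDenom K f t)⁻¹ * halfTilt f t

variable {K : Matrix n n ℂ} {f : n → ℝ} {t : ℝ}

theorem halfTilt_mul_halfTilt (f : n → ℝ) (t : ℝ) :
    halfTilt f t * halfTilt f t = diagonal fun x => (Real.exp (t * f x) : ℂ) := by
  rw [halfTilt, diagonal_mul_diagonal]
  congr 1
  ext x
  rw [← Complex.ofReal_mul, ← Real.exp_add]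
  ring_nf

theorem halfTilt_neg_mul (f : n → ℝ) (t : ℝ) : halfTilt f (-t) * halfTilt f t = 1 := by
  rw [halfTilt, halfTilt, diagonal_mul_diagonal, ← diagonal_one]
  congr 1
  ext x
  rw [← Complex.ofReal_mul, ← Real.exp_add]
  ring_nf
  simp

theorem isHermitian_halfTilt {n : Type*} [DecidableEq n] (f : n → ℝ) (t : ℝ) : (halfTilt f t).IsHermitian :=
  isHermitian_diagonal_of_self_adjoint _ (by ext; simp [-Complex.ofReal_exp])

theorem tiltKernel_zero (K : Matrix n n ℂ) (f : n → ℝ) : tiltKernel K f 0 = K := by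
  simp [tiltKernel, tiltDenom, halfTilt]

theorem posSemidef_tiltKernel (hK : K.PosSemidef) (hK' : (1 - K).PosSemidef)
    (hW : IsUnit (tiltDenom K f t)) : (tiltKernel K f t).PosSemidef := by
  have hX := isHermitian_halfTilt f t
  rw [Matrix.isUnit_iff_isUnit_det] at hW
  have hW' := Matrix.mul_nonsing_inv _ hW
  have hWs : (tiltDenom K f t)ᴴ = 1 + K * (halfTilt f t * halfTilt f t - 1) := by
    simp [tiltDenom, hK.1.eq, hX.eq]
  set X := halfTilt f t
  set W := tiltDenom K f t
  have h1 := ((hK.mul_one_sub_self hK').add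
    ((posSemidef_self_mul_conjTranspose (K * X)))).conjTranspose_mul_mul_same (W⁻¹ * X)
  have h2 : K * (1 - K) + K * X * (K * X)ᴴ = Wᴴ * K := by
    rw [conjTranspose_mul, hX.eq, hK.1.eq, hWs]
    noncomm_ring
  have h3 : (W⁻¹)ᴴ * Wᴴ = 1 := by rw [← conjTranspose_mul, hW', conjTranspose_one]
  convert h1 using 1
  rw [h2, conjTranspose_mul, hX.eq]
  calc X * K * W⁻¹ * X = X * 1 * K * W⁻¹ * X := by rw [mul_one]
    _ = _ := by rw [← h3]; simp only [mul_assoc]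

theorem posSemidef_one_sub_tiltKernel (hK : K.PosSemidef) (hK' : (1 - K).PosSemidef)
    (hW : IsUnit (tiltDenom K f t)) : (1 - tiltKernel K f t).PosSemidef := by
  have hX := isHermitian_halfTilt f t
  have hY := isHermitian_halfTilt f (-t)
  have hYX := halfTilt_neg_mul f t
  have hXY : halfTilt f t * halfTilt f (-t) = 1 := by
    simpa using halfTilt_neg_mul f (-t)
  rw [Matrix.isUnit_iff_isUnit_det] at hW
  have hW' := Matrix.mul_nonsing_inv _ hW
  have hWs : (tiltDenom K f t)ᴴ = 1 + K * (halfTilt f t * halfTilt f t - 1) := by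
    simp [tiltDenom, hK.1.eq, hX.eq]
  have hWd : tiltDenom K f t = 1 + (halfTilt f t * halfTilt f t - 1) * K := rfl
  set X := halfTilt f t
  set Y := halfTilt f (-t)
  set W := tiltDenom K f t
  have h1 := ((hK.mul_one_sub_self hK').add
    ((posSemidef_self_mul_conjTranspose ((1 - K) * Y)))).conjTranspose_mul_mul_same (W⁻¹ * X)
  have hYW : Y * W = Y * (1 - K) + X * K := by
    calc Y * W = Y * (1 - K) + (Y * X) * X * K := by rw [hWd]; noncomm_ring
      _ = _ := by rw [hYX, one_mul]
  have hWY : Wᴴ * Y = (1 - K) * Y + K * X := by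
    calc Wᴴ * Y = (1 - K) * Y + K * X * (X * Y) := by rw [hWs]; noncomm_ring
      _ = _ := by rw [hXY, mul_one]
  have h2 : K * (1 - K) + (1 - K) * Y * ((1 - K) * Y)ᴴ = Wᴴ * Y * (Y * W) - Wᴴ * K := by
    rw [conjTranspose_mul, hY.eq, hK'.1.eq, hYW, hWY, hWs]
    calc _ = ((1 - K) * Y + K * X) * (Y * (1 - K) + X * K) - (1 + K * (X * X - 1)) * K
          + (K * (1 - K) - (1 - K) * (Y * X) * K - K * (X * Y) * (1 - K) + K - K * K) := by
            noncomm_ring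
      _ = _ := by rw [hXY, hYX]; noncomm_ring
  have h3 : (W⁻¹)ᴴ * Wᴴ = 1 := by rw [← conjTranspose_mul, hW', conjTranspose_one]
  convert h1 using 1
  rw [h2, conjTranspose_mul, hX.eq]
  calc 1 - X * K * W⁻¹ * X = (X * 1 * Y) * (Y * 1 * X) - X * 1 * K * W⁻¹ * X := by
        rw [mul_one, hXY, mul_one, hYX, one_mul]
    _ = (X * ((W⁻¹)ᴴ * Wᴴ) * Y) * (Y * (W * W⁻¹) * X) - X * ((W⁻¹)ᴴ * Wᴴ) * K * W⁻¹ * X := by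
        rw [h3, hW']
    _ = _ := by noncomm_ring

theorem diagonal_mul_halfTilt_comm (f : n → ℝ) (t : ℝ) :
    diagonal (fun x => (f x : ℂ)) * halfTilt f t = halfTilt f t * diagonal fun x => (f x : ℂ) := by
  simp [halfTilt, diagonal_mul_diagonal, mul_comm]

theorem hasDerivAt_halfTilt (f : n → ℝ) (t : ℝ) :
    HasDerivAt (halfTilt f)
      ((1 / 2 : ℂ) • (diagonal (fun x => (f x : ℂ)) * halfTilt f t)) t := by
  have h : HasDerivAt (fun s : ℝ => fun x => (Real.exp (s * f x / 2) : ℂ))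
      (fun x => ((Real.exp (t * f x / 2) * (f x / 2) : ℝ) : ℂ)) t := by
    rw [hasDerivAt_pi]
    intro x
    have := ((hasDerivAt_mul_const (x := t) (f x)).div_const 2).exp
    exact this.ofReal_comp
  have := (LinearMap.toContinuousLinearMap
    (Matrix.diagonalLinearMap n ℝ ℂ)).hasFDerivAt.comp_hasDerivAt t h
  refine HasDerivAt.congr_deriv (f := halfTilt f) this ?_
  change diagonal _ = _
  ext i j
  by_cases hij : i = j
  · subst hij
    simp [halfTilt]
    ring
  · simp [halfTilt, hij]

theorem hasDerivAt_nonsing_inv {W : ℝ → Matrix n n ℂ} {W' : Matrix n n ℂ}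
    (h : HasDerivAt W W' t) (hu : IsUnit (W t)) :
    HasDerivAt (fun s => (W s)⁻¹) (-((W t)⁻¹ * W' * (W t)⁻¹)) t := by
  obtain ⟨u, hu⟩ := hu
  have h1 := hasFDerivAt_ringInverse (𝕜 := ℝ) u
  rw [hu] at h1
  have h2 := h1.comp_hasDerivAt t h
  have h3 : (W t)⁻¹ = ((u⁻¹ : (Matrix n n ℂ)ˣ) : Matrix n n ℂ) := by
    rw [← hu, Matrix.coe_units_inv]
  rw [h3]
  rw [show (fun s => (W s)⁻¹) = Ring.inverse ∘ W from
    funext fun s => Matrix.nonsing_inv_eq_ringInverse (W s)]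
  refine h2.congr_deriv ?_
  simp

/-- The tilted kernel solves a Riccati equation. -/
theorem hasDerivAt_tiltKernel (hW : IsUnit (tiltDenom K f t)) :
    HasDerivAt (tiltKernel K f)
      ((1 / 2 : ℂ) • (diagonal (fun x => (f x : ℂ)) * tiltKernel K f t +
        tiltKernel K f t * diagonal fun x => (f x : ℂ)) -
        tiltKernel K f t * diagonal (fun x => (f x : ℂ)) * tiltKernel K f t) t := by
  have hX := hasDerivAt_halfTilt f t
  have hcomm := diagonal_mul_halfTilt_comm f t
  have hWd : HasDerivAt (tiltDenom K f) _ t :=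
    (((hX.mul hX).sub_const 1).mul_const K).const_add 1
  have h := ((hX.mul_const K).mul (hasDerivAt_nonsing_inv hWd hW)).mul hX
  refine HasDerivAt.congr_deriv (f := tiltKernel K f) h ?_
  simp only [tiltKernel]
  set X := halfTilt f t
  set W := (tiltDenom K f t)⁻¹
  set F : Matrix n n ℂ := diagonal fun x => (f x : ℂ)
  have h1 : (1 / 2 : ℂ) • (F * X) * X + X * ((1 / 2 : ℂ) • (F * X)) = X * F * X := by
    rw [Matrix.mul_smul, ← mul_assoc X F X, ← hcomm, Matrix.smul_mul, ← add_smul]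
    norm_num
  have h2 : X * K * W * ((1 / 2 : ℂ) • (F * X)) = (1 / 2 : ℂ) • (X * K * W * X * F) := by
    rw [hcomm, Matrix.mul_smul, ← mul_assoc]
  rw [h1]
  change _ + X * K * W * ((1 / 2 : ℂ) • (F * X)) = _
  rw [h2]
  simp only [smul_add, add_mul, mul_neg, neg_mul, Matrix.smul_mul, mul_assoc]
  abel

end Tilt

section Cumulants

open scoped Matrix.Norms.Operator

variable {n : Type*} [Fintype n] [DecidableEq n] {K : Matrix n n ℂ} {f : n → ℝ} {t : ℝ}

theorem HasDerivAt.re_trace {n : Type*} [Fintype n] {t : ℝ} {A : ℝ → Matrix n n ℂ} {A' : Matrix n n ℂ} (h : HasDerivAt A A' t) :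
    HasDerivAt (fun s => (A s).trace.re) A'.trace.re t :=
  (LinearMap.toContinuousLinearMap
    (Complex.reLm.comp (Matrix.traceLinearMap n ℝ ℂ))).hasFDerivAt.comp_hasDerivAt t h

theorem hasDerivAt_re_trace_tiltKernel (hW : IsUnit (tiltDenom K f t)) :
    HasDerivAt (fun s => (diagonal (fun x => (f x : ℂ)) * tiltKernel K f s).trace.re)
      (varianceForm (diagonal fun x => (f x : ℂ)) (tiltKernel K f t)) t := by
  convert ((hasDerivAt_tiltKernel hW).const_mul (diagonal fun x => (f x : ℂ))).re_trace using 1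
  set P := tiltKernel K f t
  set F : Matrix n n ℂ := diagonal fun x => (f x : ℂ)
  rw [varianceForm]
  congr 1
  have h := trace_mul_comm (F * P) F
  simp only [mul_assoc] at h
  simp only [mul_add, mul_sub, Matrix.mul_smul, trace_add, trace_sub, trace_smul, mul_assoc, h,
    smul_eq_mul]
  ring

theorem hasDerivAt_varianceForm_tiltKernel_le (hK : K.PosSemidef) (hK' : (1 - K).PosSemidef)
    (hW : IsUnit (tiltDenom K f t)) {M : ℝ} (hM : 0 ≤ M) (hf : ∀ x, |f x| ≤ M) :
    ∃ v', HasDerivAt (fun s => varianceForm (diagonal fun x => (f x : ℂ)) (tiltKernel K f s)) v' t ∧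
      v' ≤ 2 * M * varianceForm (diagonal fun x => (f x : ℂ)) (tiltKernel K f t) := by
  have hP := hasDerivAt_tiltKernel hW
  have hF : (diagonal fun x => (f x : ℂ)).IsHermitian :=
    isHermitian_diagonal_of_self_adjoint _ (by ext; simp)
  have hdiag : (M : ℂ) • (1 : Matrix n n ℂ) = diagonal fun _ => (M : ℂ) := by
    rw [← diagonal_one, ← diagonal_smul]
    congr 1
    ext
    simp
  refine ⟨_, (((hP.const_mul _).sub (((hP.const_mul _).mul_const _).mul hP)).re_trace),
    le_trans (le_of_eq ?_) (third_cumulant_le (posSemidef_tiltKernel hK hK' hW)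
      (posSemidef_one_sub_tiltKernel hK hK' hW) hF hM ?_ ?_ rfl)⟩
  · rfl
  · rw [hdiag, diagonal_add]
    refine PosSemidef.diagonal fun x => ?_
    have := neg_le_of_abs_le (hf x)
    simp only [Pi.zero_apply]
    exact_mod_cast (by linarith : 0 ≤ M + f x)
  · rw [hdiag, diagonal_sub]
    refine PosSemidef.diagonal fun x => ?_
    have := le_of_abs_le (hf x)
    simp only [Pi.zero_apply]
    exact_mod_cast (by linarith : 0 ≤ M - f x)

end Cumulants

namespace IsDPPLaw

variable {N : ℕ} {μ : Finset (Fin N) → ℝ} {K : Matrix (Fin N) (Fin N) ℂ}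

/-- The reweighted one-point function of a DPP. -/
theorem sum_mul_ite_mem_mul_prod (h : IsDPPLaw μ K) (g : Fin N → ℂ)
    (hdet : (1 + (diagonal g - 1) * K).det ≠ 0) (x : Fin N) :
    ∑ S, (μ S : ℂ) * (if x ∈ S then ∏ y ∈ S, g y else 0) =
      (1 + (diagonal g - 1) * K).det * (diagonal g * K * (1 + (diagonal g - 1) * K)⁻¹) x x := by
  set W := 1 + (diagonal g - 1) * K with hWdef
  have hprod (S : Finset (Fin N)) : ∏ y ∈ S, Function.update g x 0 y =
      ∏ y ∈ S, g y - if x ∈ S then ∏ y ∈ S, g y else 0 := by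
    split_ifs with hx
    · rw [Finset.prod_eq_zero hx (by simp), sub_self]
    · rw [Finset.prod_update_of_notMem hx, sub_zero]
  have hentry (c : Fin N → ℂ) (i j : Fin N) :
      (1 + (diagonal c - 1) * K) i j = (1 : Matrix (Fin N) (Fin N) ℂ) i j + (c i - 1) * K i j := by
    rw [← Matrix.diagonal_one, Matrix.diagonal_sub]
    simp [Matrix.diagonal_mul]
  set W' := 1 + (diagonal (Function.update g x 0) - 1) * K with hW'def
  have hW' : W' = W.updateRow x (W' x) := by
    ext i j
    by_cases hi : i = x
    · subst hi
      simp
    · rw [Matrix.updateRow_ne hi, hW'def, hWdef, hentry, hentry, Function.update_of_ne hi]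
  have hrow : W = W.updateRow x (W' x + fun j => g x * K x j) := by
    ext i j
    by_cases hi : i = x
    · subst hi
      rw [Matrix.updateRow_self, Pi.add_apply, hW'def, hWdef, hentry, hentry, Function.update_self]
      ring
    · rw [Matrix.updateRow_ne hi]
  have hsplit : W.det = W'.det + (W.updateRow x fun j => g x * K x j).det := by
    conv_lhs => rw [hrow, Matrix.det_updateRow_add, ← hW']
  have hW1 := h.sum_mul_prod_eq_det g
  have hW2 := h.sum_mul_prod_eq_det (Function.update g x 0)
  rw [← hWdef] at hW1
  rw [← hW'def] at hW2
  simp_rw [hprod, mul_sub, Finset.sum_sub_distrib] at hW2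
  rw [hW1, hsplit] at hW2
  have hlhs : ∑ S, (μ S : ℂ) * (if x ∈ S then ∏ y ∈ S, g y else 0) =
      (W.updateRow x fun j => g x * K x j).det := by linear_combination -hW2
  rw [hlhs, ← Matrix.cramer_transpose_apply, Matrix.cramer_eq_adjugate_mulVec,
    ← Matrix.adjugate_transpose, Matrix.inv_def, Ring.inverse_eq_inv', Matrix.mul_smul,
    Matrix.smul_apply, smul_eq_mul, mul_inv_cancel_left₀ hdet, Matrix.mul_apply]
  simp only [Matrix.mulVec, dotProduct, Matrix.transpose_apply, Matrix.diagonal_mul]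
  exact Finset.sum_congr rfl fun _ _ => mul_comm _ _

theorem ofReal_sum_mul_exp (h : IsDPPLaw μ K) (f : Fin N → ℝ) (t : ℝ) :
    ((∑ S, μ S * Real.exp (t * ∑ x ∈ S, f x) : ℝ) : ℂ) = (tiltDenom K f t).det := by
  rw [tiltDenom, halfTilt_mul_halfTilt, ← h.sum_mul_prod_eq_det]
  push_cast
  refine Finset.sum_congr rfl fun S _ => ?_
  rw [← Complex.exp_sum, Finset.mul_sum]

theorem isUnit_tiltDenom (h : IsDPPLaw μ K) (f : Fin N → ℝ) (t : ℝ) :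
    IsUnit (tiltDenom K f t) := by
  rw [Matrix.isUnit_iff_isUnit_det, isUnit_iff_ne_zero, ← h.ofReal_sum_mul_exp]
  exact_mod_cast (h.sum_mul_pos fun S => Real.exp_pos _).ne'

/-- The reweighted mean of a linear statistic is the trace of `f` against the tilted kernel. -/
theorem sum_mul_sum_mul_exp (h : IsDPPLaw μ K) (f : Fin N → ℝ) (t : ℝ) :
    ∑ S, μ S * ((∑ x ∈ S, f x) * Real.exp (t * ∑ x ∈ S, f x)) =
      (∑ S, μ S * Real.exp (t * ∑ x ∈ S, f x)) *
        (diagonal (fun x => (f x : ℂ)) * tiltKernel K f t).trace.re := by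
  have hdet := (Matrix.isUnit_iff_isUnit_det _).mp (h.isUnit_tiltDenom f t) |>.ne_zero
  have hpt := h.sum_mul_ite_mem_mul_prod (fun x => (Real.exp (t * f x) : ℂ))
  rw [← halfTilt_mul_halfTilt] at hpt
  have htr : (diagonal (fun x => (f x : ℂ)) * tiltKernel K f t).trace =
      ∑ x, (f x : ℂ) * (halfTilt f t * halfTilt f t * K * (tiltDenom K f t)⁻¹) x x := by
    have : halfTilt f t * (diagonal (fun x => (f x : ℂ)) * (halfTilt f t * K *
        (tiltDenom K f t)⁻¹)) = diagonal (fun x => (f x : ℂ)) *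
        (halfTilt f t * halfTilt f t * K * (tiltDenom K f t)⁻¹) := by
      simp only [← mul_assoc]
      rw [diagonal_mul_halfTilt_comm]
    rw [tiltKernel, ← mul_assoc, trace_mul_comm, this]
    simp only [trace, diag_apply, diagonal_mul]
  have hC : ((∑ S, μ S * ((∑ x ∈ S, f x) * Real.exp (t * ∑ x ∈ S, f x)) : ℝ) : ℂ) =
      (∑ S, μ S * Real.exp (t * ∑ x ∈ S, f x) : ℝ) *
        (diagonal (fun x => (f x : ℂ)) * tiltKernel K f t).trace := by
    rw [h.ofReal_sum_mul_exp, htr, Finset.mul_sum]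
    have hx (x : Fin N) : (tiltDenom K f t).det *
        ((f x : ℂ) * (halfTilt f t * halfTilt f t * K * (tiltDenom K f t)⁻¹) x x) =
        ∑ S, (f x : ℂ) *
          ((μ S : ℂ) * (if x ∈ S then ∏ y ∈ S, (Real.exp (t * f y) : ℂ) else 0)) := by
      rw [← Finset.mul_sum, hpt hdet x, tiltDenom]
      ring
    simp_rw [hx]
    rw [Finset.sum_comm]
    push_cast
    refine Finset.sum_congr rfl fun S _ => ?_
    simp only [mul_ite, mul_zero]
    rw [Finset.sum_ite_mem, Finset.univ_inter, Finset.mul_sum, Complex.exp_sum, Finset.sum_mul,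
      Finset.mul_sum]
    exact Finset.sum_congr rfl fun _ _ => by ring
  have := congrArg Complex.re hC
  rwa [Complex.ofReal_re, Complex.re_ofReal_mul] at this

end IsDPPLaw

namespace IsDPPLaw

variable {N : ℕ} {μ : Finset (Fin N) → ℝ} {K : Matrix (Fin N) (Fin N) ℂ}

theorem hasDerivAt_laplace (μ : Finset (Fin N) → ℝ) (f : Fin N → ℝ) (t : ℝ) :
    HasDerivAt (fun s => ∑ S, μ S * Real.exp (s * ∑ x ∈ S, f x))
      (∑ S, μ S * ((∑ x ∈ S, f x) * Real.exp (t * ∑ x ∈ S, f x))) t := by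
  refine HasDerivAt.fun_sum fun S _ => HasDerivAt.const_mul _ ?_
  exact (hasDerivAt_mul_const (x := t) (∑ x ∈ S, f x)).exp.congr_deriv (mul_comm _ _)

theorem hasDerivAt_laplace_deriv_zero (μ : Finset (Fin N) → ℝ) (f : Fin N → ℝ) :
    HasDerivAt (fun s => ∑ S, μ S * ((∑ x ∈ S, f x) * Real.exp (s * ∑ x ∈ S, f x)))
      (∑ S, μ S * (∑ x ∈ S, f x) ^ 2) 0 := by
  refine HasDerivAt.fun_sum fun S _ => HasDerivAt.const_mul _ ?_
  convert (hasDerivAt_mul_const (x := (0 : ℝ)) (∑ x ∈ S, f x)).exp.const_mul (∑ x ∈ S, f x) using 1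
  simp [sq]

theorem dppVar_eq (h : IsDPPLaw μ K) (f : Fin N → ℝ) :
    dppVar μ f = ∑ S, μ S * (∑ x ∈ S, f x) ^ 2 - dppMean μ f ^ 2 := by
  have h1 (S : Finset (Fin N)) : μ S * ((∑ x ∈ S, f x) - dppMean μ f) ^ 2 =
      μ S * (∑ x ∈ S, f x) ^ 2 - 2 * dppMean μ f * (μ S * ∑ x ∈ S, f x) +
        dppMean μ f ^ 2 * μ S := by ring
  rw [dppVar]
  simp_rw [h1]
  rw [Finset.sum_add_distrib, Finset.sum_sub_distrib, ← Finset.mul_sum, ← Finset.mul_sum, h.2.1,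
    ← dppMean]
  ring

theorem dppVar_nonneg (h : IsDPPLaw μ K) (f : Fin N → ℝ) : 0 ≤ dppVar μ f :=
  Finset.sum_nonneg fun S _ => mul_nonneg (h.1 S) (sq_nonneg _)

theorem re_trace_tiltKernel_zero (h : IsDPPLaw μ K) (f : Fin N → ℝ) :
    (diagonal (fun x => (f x : ℂ)) * tiltKernel K f 0).trace.re = dppMean μ f := by
  have := h.sum_mul_sum_mul_exp f 0
  simpa [h.2.1, dppMean] using this.symm

theorem varianceForm_eq_dppVar (h : IsDPPLaw μ K) (f : Fin N → ℝ) :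
    varianceForm (diagonal fun x => (f x : ℂ)) (tiltKernel K f 0) = dppVar μ f := by
  have h1 := (hasDerivAt_laplace μ f 0).fun_mul
    (hasDerivAt_re_trace_tiltKernel (h.isUnit_tiltDenom f 0))
  simp_rw [← h.sum_mul_sum_mul_exp] at h1
  have h2 := h1.unique (hasDerivAt_laplace_deriv_zero μ f)
  rw [h.re_trace_tiltKernel_zero] at h2
  have h3 : ∑ S, μ S * ∑ x ∈ S, f x = dppMean μ f := rfl
  simp only [zero_mul, Real.exp_zero, mul_one, h.2.1, one_mul, h3] at h2
  rw [h.dppVar_eq, ← h2]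
  ring

/-- The Laplace transform of a linear statistic of a DPP with Hermitian kernel is sub-Gaussian
near the origin. -/
theorem sum_mul_exp_le (h : IsDPPLaw μ K) (hK : K.IsHermitian) {f : Fin N → ℝ} {M : ℝ}
    (hM : 0 < M) (hf : ∀ x, |f x| ≤ M) {t : ℝ} (ht : 0 ≤ t) (htM : t ≤ 1 / (3 * M)) :
    ∑ S, μ S * Real.exp (t * ∑ x ∈ S, f x) ≤
      Real.exp (t * dppMean μ f + dppVar μ f * t ^ 2) := by
  set F : Matrix (Fin N) (Fin N) ℂ := diagonal fun x => (f x : ℂ)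
  have hV := h.dppVar_nonneg f
  set V := dppVar μ f
  set m := dppMean μ f
  have hv (s : ℝ) (hs : s ∈ Set.Icc 0 t) : varianceForm F (tiltKernel K f s) ≤ 2 * V := by
    have hanti : Antitone fun s => varianceForm F (tiltKernel K f s) * Real.exp (-(2 * M) * s) := by
      choose v' hv' hle using fun s => hasDerivAt_varianceForm_tiltKernel_le (h.posSemidef hK)
        (h.posSemidef_one_sub hK) (h.isUnit_tiltDenom f s) hM.le hf
      refine antitone_of_hasDerivAt_nonpos
        (fun s => (hv' s).mul ((hasDerivAt_const_mul (-(2 * M))).exp)) fun s => ?_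
      have := Real.exp_pos (-(2 * M) * s)
      have h1 := hle s
      simp only [Pi.zero_apply]
      nlinarith
    have h1 := hanti hs.1
    simp only [F, h.varianceForm_eq_dppVar, mul_zero, Real.exp_zero, mul_one] at h1
    have h2 : (1 : ℝ) / 2 ≤ Real.exp (-(2 * M) * s) := by
      have : -Real.log 2 ≤ -(2 * M) * s := by
        have h3 : s ≤ 1 / (3 * M) := hs.2.trans htM
        rw [le_div_iff₀ (by positivity)] at h3
        have := Real.log_two_gt_d9
        linarith
      calc (1 : ℝ) / 2 = Real.exp (-Real.log 2) := by
            rw [Real.exp_neg, Real.exp_log two_pos, one_div]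
        _ ≤ _ := Real.exp_le_exp.mpr this
    have h3 : 0 ≤ varianceForm F (tiltKernel K f s) :=
      varianceForm_nonneg
        (posSemidef_tiltKernel (h.posSemidef hK) (h.posSemidef_one_sub hK) (h.isUnit_tiltDenom f s))
        (posSemidef_one_sub_tiltKernel (h.posSemidef hK) (h.posSemidef_one_sub hK)
          (h.isUnit_tiltDenom f s))
        (isHermitian_diagonal_of_self_adjoint _ (by ext; simp))
    nlinarith
  have hp (s : ℝ) (hs : s ∈ Set.Icc 0 t) : (F * tiltKernel K f s).trace.re ≤ m + 2 * V * s := by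
    have hd (s : ℝ) := (hasDerivAt_re_trace_tiltKernel (h.isUnit_tiltDenom f s)).sub
      (hasDerivAt_const_mul (x := s) (2 * V))
    have hanti : AntitoneOn (fun s => (F * tiltKernel K f s).trace.re - 2 * V * s)
        (Set.Icc 0 t) := by
      refine antitoneOn_of_hasDerivWithinAt_nonpos (convex_Icc 0 t)
        (fun s _ => (hd s).continuousAt.continuousWithinAt)
        (fun s _ => (hd s).hasDerivWithinAt) fun s hs => ?_
      linarith [hv s (interior_subset hs)]
    have := hanti (Set.left_mem_Icc.mpr ht) hs hs.1
    simp only [F, h.re_trace_tiltKernel_zero] at this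
    linarith
  have hd (s : ℝ) := (hasDerivAt_laplace μ f s).mul
    (((hasDerivAt_mul_const (x := s) m).add ((hasDerivAt_pow 2 s).const_mul V)).neg.exp)
  have hanti : AntitoneOn (fun s => (∑ S, μ S * Real.exp (s * ∑ x ∈ S, f x)) *
      Real.exp (-(s * m + V * s ^ 2))) (Set.Icc 0 t) := by
    refine antitoneOn_of_hasDerivWithinAt_nonpos (convex_Icc 0 t)
      (fun s _ => (hd s).continuousAt.continuousWithinAt)
      (fun s _ => (hd s).hasDerivWithinAt) fun s hs => ?_
    have h1 := hp s (interior_subset hs)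
    have h2 := h.sum_mul_pos fun S => Real.exp_pos (s * ∑ x ∈ S, f x)
    rw [h.sum_mul_sum_mul_exp]
    have h3 := mul_nonneg (mul_pos h2 (Real.exp_pos (-(s * m + V * s ^ 2)))).le (sub_nonneg.mpr h1)
    simp only [Pi.add_apply, Pi.neg_apply]
    push_cast
    linarith
  have := hanti (Set.left_mem_Icc.mpr ht) (Set.right_mem_Icc.mpr ht) ht
  simp only [zero_mul, ne_eq, OfNat.ofNat_ne_zero, not_false_eq_true, zero_pow, mul_zero, add_zero,
    neg_zero, Real.exp_zero, mul_one, h.2.1] at this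
  rwa [Real.exp_neg, ← div_eq_mul_inv, div_le_one (Real.exp_pos _)] at this

theorem sum_filter_le (h : IsDPPLaw μ K) (hK : K.IsHermitian) {f : Fin N → ℝ} {M a : ℝ}
    (hM : 0 < M) (hf : ∀ x, |f x| ≤ M) (hV : 0 < dppVar μ f) (ha : 0 ≤ a)
    (haM : a ≤ 2 * dppVar μ f / (3 * M)) :
    ∑ T ∈ Finset.univ.filter (fun T : Finset (Fin N) => a ≤ (∑ x ∈ T, f x) - dppMean μ f), μ T ≤
      Real.exp (-(a ^ 2) / (4 * dppVar μ f)) := by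
  set V := dppVar μ f with hVdef
  set m := dppMean μ f
  set t := a / (2 * V) with ht
  have ht0 : 0 ≤ t := by positivity
  have htM : t ≤ 1 / (3 * M) := by
    rw [ht, div_le_div_iff₀ (by positivity) (by positivity)]
    rw [le_div_iff₀ (by positivity)] at haM
    linarith
  have hL := h.sum_mul_exp_le hK hM hf ht0 htM
  rw [← hVdef] at hL
  calc _ ≤ ∑ T ∈ Finset.univ.filter (fun T : Finset (Fin N) => a ≤ (∑ x ∈ T, f x) - m),
        Real.exp (-(t * (m + a))) * (μ T * Real.exp (t * ∑ x ∈ T, f x)) := by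
        refine Finset.sum_le_sum fun T hT => ?_
        have hT' := (Finset.mem_filter.mp hT).2
        have h1 : 1 ≤ Real.exp (-(t * (m + a)) + t * ∑ x ∈ T, f x) := by
          rw [Real.one_le_exp_iff]
          nlinarith
        rw [Real.exp_add] at h1
        nlinarith [h.1 T]
    _ ≤ ∑ T, Real.exp (-(t * (m + a))) * (μ T * Real.exp (t * ∑ x ∈ T, f x)) :=
        Finset.sum_le_sum_of_subset_of_nonneg (Finset.filter_subset _ _) fun T _ _ =>
          mul_nonneg (Real.exp_pos _).le (mul_nonneg (h.1 T) (Real.exp_pos _).le)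
    _ ≤ Real.exp (-(t * (m + a))) * Real.exp (t * m + V * t ^ 2) := by
        rw [← Finset.mul_sum]
        exact mul_le_mul_of_nonneg_left hL (Real.exp_pos _).le
    _ = _ := by
        rw [← Real.exp_add, ht]
        congr 1
        field_simp
        ring

end IsDPPLaw

theorem dppMean_neg {N : ℕ} (μ : Finset (Fin N) → ℝ) (f : Fin N → ℝ) :
    dppMean μ (-f) = -dppMean μ f := by
  simp [dppMean]

theorem dppVar_neg {N : ℕ} (μ : Finset (Fin N) → ℝ) (f : Fin N → ℝ) :
    dppVar μ (-f) = dppVar μ f := by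
  simp only [dppVar, dppMean_neg, Pi.neg_apply, Finset.sum_neg_distrib]
  exact Finset.sum_congr rfl fun _ _ => by ring

end

/-- **Bernstein-type concentration for DPPs with Hermitian kernels.** There is a universal
constant `A > 0` such that for every DPP `S` on a finite set with Hermitian kernel `K` and
every bounded `f`, for all `0 ≤ a ≤ 2A·Var[Λ_S(f)]/(3‖f‖_∞)`,
`P(|Λ_S(f) − E[Λ_S(f)]| ≥ a) ≤ 2 exp(−a²/(4A·Var[Λ_S(f)]))`. -/
theorem dpp_bernstein_hermitian :
    ∃ A : ℝ, 0 < A ∧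
      ∀ (N : ℕ) (K : Matrix (Fin N) (Fin N) ℂ), K.IsHermitian →
      ∀ μ : Finset (Fin N) → ℝ, IsDPPLaw μ K →
      ∀ f : Fin N → ℝ, ∀ a : ℝ,
        0 ≤ a → a ≤ 2 * A * dppVar μ f / (3 * ⨆ x : Fin N, |f x|) →
        (∑ T ∈ Finset.univ.filter (fun T : Finset (Fin N) =>
            a ≤ |(∑ x ∈ T, f x) - dppMean μ f|), μ T)
          ≤ 2 * Real.exp (-(a ^ 2) / (4 * A * dppVar μ f)) := by
  refine ⟨1, one_pos, fun N K hK μ h f a ha haM => ?_⟩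
  rw [mul_one] at haM ⊢
  set M := ⨆ x : Fin N, |f x|
  have hf (x : Fin N) : |f x| ≤ M := le_ciSup (f := fun x => |f x|) (Set.finite_range _).bddAbove x
  rcases ha.eq_or_lt with rfl | ha'
  · have : ∑ T ∈ Finset.univ.filter (fun T : Finset (Fin N) =>
        0 ≤ |(∑ x ∈ T, f x) - dppMean μ f|), μ T ≤ ∑ T, μ T :=
      Finset.sum_le_sum_of_subset_of_nonneg (Finset.filter_subset _ _) fun T _ _ => h.1 T
    rw [h.2.1] at this
    norm_num
    norm_num at this
    linarith
  · have hM0 : 0 ≤ M := Real.iSup_nonneg fun x => abs_nonneg (f x)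
    have hpos := ha'.trans_le haM
    have hM : 0 < M := hM0.lt_of_ne' fun h0 => by simp [h0] at hpos
    have hV : 0 < dppVar μ f := (h.dppVar_nonneg f).lt_of_ne' fun h0 => by simp [h0] at hpos
    have h1 := h.sum_filter_le hK hM hf hV ha haM
    have h2 := h.sum_filter_le hK (f := -f) hM (by simpa using hf) (by rwa [dppVar_neg]) ha
      (by rwa [dppVar_neg])
    rw [dppVar_neg, dppMean_neg] at h2
    rw [two_mul]
    refine le_trans ?_ (add_le_add h1 h2)
    simp only [Finset.sum_filter]
    rw [← Finset.sum_add_distrib]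
    refine Finset.sum_le_sum fun T _ => ?_
    have hμ := h.1 T
    simp only [Pi.neg_apply, Finset.sum_neg_distrib]
    by_cases hT : a ≤ |(∑ x ∈ T, f x) - dppMean μ f|
    · rw [if_pos hT]
      rcases le_abs.mp hT with h3 | h3
      · rw [if_pos h3]
        split_ifs <;> linarith
      · rw [if_pos (by linarith : a ≤ -∑ x ∈ T, f x - -dppMean μ f)]
        split_ifs <;> linarith
    · rw [if_neg hT]
      split_ifs <;> linarith
end

section
/- There exist a universal constant A > 0 such that the following holds. Let S be a determinantal point process on a finite set X = {x_1,...,x_N} with Hermitian kernel matrix K, let m = E[|S|], and assume K_{ii} ≥ ρ m / N for all i and some ρ > 0. Let F be a family of bounded real-valued functions on X with dim span_ℝ(F) = D < ∞. For f ∈ F let L(f) = Σ_{x∈X} f(x) and L_S(f) = Σ_{x_i∈S} f(x_i)/K_{ii}, and assume |L(f)|/N ≥ c for all f ∈ F and some c > 0. Let V ≥ sup_{f∈F} Var[N^{-1} L_S(f)]. Then for all ε with 0 ≤ ε ≤ 4 A ρ m V / (3 c sup_{f∈F} ‖f‖_∞), P( ∃ f ∈ F : |L_S(f)/L(f) − 1|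 ≥ ε ) ≤ 2 exp( 6D − c² ε² / (16 A V) ). -/
open scoped Classical

/-- Mean of a statistic `g` of the random subset, under the law `μ`. -/
noncomputable def statMean {N : ℕ} (μ : Finset (Fin N) → ℝ)
    (g : Finset (Fin N) → ℝ) : ℝ :=
  ∑ T : Finset (Fin N), μ T * g T

/-- Variance of a statistic `g` of the random subset, under the law `μ`. -/
noncomputable def statVar {N : ℕ} (μ : Finset (Fin N) → ℝ)
    (g : Finset (Fin N) → ℝ) : ℝ :=
  ∑ T : Finset (Fin N), μ T * (g T - statMean μ g) ^ 2

/-- The coreset estimator `L_S(f) = ∑_{x_i ∈ S} f(x_i)/K_{ii}` for a Hermitian kernel `K`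
(whose diagonal entries are real). -/
noncomputable def coresetEstimator {N : ℕ} (K : Matrix (Fin N) (Fin N) ℂ)
    (f : Fin N → ℝ) (T : Finset (Fin N)) : ℝ :=
  ∑ i ∈ T, f i / (K i i).re

section Matrices

open Matrix ComplexOrder

variable {n : Type*} [Fintype n] [DecidableEq n]

/-- The determinant of `1 + M` is the sum of all principal minors of `M`. -/
theorem det_add_one_eq_sum_principal_minors {R : Type*} [CommRing R] (M : Matrix n n R) :
    (M + 1).det = ∑ A : Finset n, (M.submatrix (fun i : A => (i : n)) (fun j : A => (j : n))).det := by
  refine ((detRowAlternating (n := n) (R := R)).map_add_univ M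
    (fun i => (1 : Matrix n n R) i)).trans ?_
  refine Finset.sum_congr rfl fun A _ => ?_
  set P : Matrix n n R := Matrix.of fun i j => if i ∈ A then M i j else (1 : Matrix n n R) i j
    with hP
  have hpw : A.piecewise M (fun i => (1 : Matrix n n R) i) = fun i => P i := by
    ext i j
    by_cases hi : i ∈ A <;> simp [hP, Finset.piecewise, hi]
  refine (congrArg _ hpw).trans ?_
  change P.det = _
  rw [twoBlockTriangular_det P (fun i => i ∈ A)]
  · have h2 : toSquareBlockProp P (fun i => ¬ i ∈ A) = 1 := by
      ext i j
      simp [toSquareBlockProp_def, hP, i.2, Matrix.one_apply, Subtype.ext_iff]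
    have h1 : toSquareBlockProp P (fun i => i ∈ A) =
        M.submatrix (fun i : A => (i : n)) (fun j : A => (j : n)) := by
      ext i j
      simp [toSquareBlockProp_def, hP]
    rw [h2, det_one, mul_one, h1]
    congr!
  · intro i hi j hj
    have : i ≠ j := fun h => hi (h ▸ hj)
    simp [hP, hi, this]

theorem posSemidef_of_forall_eigenvalue_nonneg {M : Matrix n n ℂ} (hM : M.IsHermitian)
    (h : ∀ (r : ℝ) (v : n → ℂ), v ≠ 0 → M *ᵥ v = (r : ℂ) • v → 0 ≤ r) : M.PosSemidef := by
  rw [hM.posSemidef_iff_eigenvalues_nonneg]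
  intro i
  refine h _ (hM.eigenvectorBasis i) ?_ (hM.mulVec_eigenvectorBasis i)
  intro h0
  apply hM.eigenvectorBasis.toBasis.ne_zero i
  ext j
  simpa using congrFun h0 j

open scoped MatrixOrder in
theorem exists_hermitian_sqrt {K : Matrix n n ℂ} (hK : K.PosSemidef) :
    ∃ B : Matrix n n ℂ, K = B * B ∧ Bᴴ = B :=
  ⟨CFC.sqrt K, (CFC.sqrt_mul_sqrt_self K hK.nonneg).symm, (CFC.sqrt_nonneg K).posSemidef.1⟩

theorem trace_mul_re_nonneg {P Q : Matrix n n ℂ} (hP : P.PosSemidef) (hQ : Q.PosSemidef) :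
    0 ≤ (P * Q).trace.re := by
  obtain ⟨B, rfl, hB⟩ := exists_hermitian_sqrt hQ
  rw [← Matrix.mul_assoc, Matrix.trace_mul_comm, ← Matrix.mul_assoc]
  have := hP.conjTranspose_mul_mul_same B
  rw [hB] at this
  exact (Complex.nonneg_iff.mp this.trace_nonneg).1

theorem det_one_add_re_le_exp_trace {S : Matrix n n ℂ} (hS : S.PosSemidef) :
    (1 + S).det.re ≤ Real.exp S.trace.re := by
  have h1 : (1 + S).PosSemidef := PosSemidef.one.add hS
  have hd := h1.1.det_eq_prod_eigenvalues
  have ht := h1.1.trace_eq_sum_eigenvalues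
  have hd' : (1 + S).det.re = ∏ i, h1.1.eigenvalues i := by
    rw [hd]
    norm_cast
  have ht' : S.trace.re = ∑ i, (h1.1.eigenvalues i - 1) := by
    have := congrArg Complex.re ht
    simp only [trace_add, trace_one, Complex.add_re, Complex.natCast_re, Complex.re_sum] at this
    simp at this ⊢
    linarith
  rw [hd', ht', Real.exp_sum]
  refine Finset.prod_le_prod (fun i _ => h1.eigenvalues_nonneg i) fun i _ => ?_
  linarith [Real.add_one_le_exp (h1.1.eigenvalues i - 1)]

theorem det_sq_add_re_le {T R : Matrix n n ℂ} {u : ℝ} (hu : 0 < u)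
    (hT : (T - (u : ℂ) • (1 : Matrix n n ℂ)).PosSemidef) (hR : R.PosSemidef) :
    (T * T + R).det.re ≤ T.det.re ^ 2 * Real.exp (u⁻¹ ^ 2 * R.trace.re) := by
  have hu1 : ((u : ℂ) • (1 : Matrix n n ℂ)).PosDef :=
    PosDef.one.smul (by exact_mod_cast hu)
  have hTd : T.PosDef := by
    simpa using hu1.add_posSemidef hT
  have hunit : IsUnit T.det := (Matrix.isUnit_iff_isUnit_det _).mp hTd.isUnit
  have hinv : (T⁻¹)ᴴ = T⁻¹ := hTd.inv.1
  set S := T⁻¹ * R * T⁻¹ with hSdef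
  have hS : S.PosSemidef := by
    have := hR.conjTranspose_mul_mul_same T⁻¹
    rwa [hinv] at this
  have hTST : T * S * T = R := by
    rw [hSdef, Matrix.mul_assoc, Matrix.mul_assoc, Matrix.nonsing_inv_mul _ hunit,
      ← Matrix.mul_assoc, ← Matrix.mul_assoc, Matrix.mul_nonsing_inv _ hunit]
    simp
  have hfac : T * T + R = T * (1 + S) * T := by
    rw [Matrix.mul_add, Matrix.add_mul, hTST, Matrix.mul_one]
  have hdet : (T * T + R).det.re = T.det.re ^ 2 * (1 + S).det.re := by
    have h0 : T.det.im = 0 := (Complex.nonneg_iff.mp hTd.posSemidef.det_nonneg).2.symm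
    have : T.det = (T.det.re : ℂ) := Complex.ext rfl (by simpa using h0)
    rw [hfac, det_mul, det_mul, this]
    simp
    ring
  have htr : u ^ 2 * S.trace.re ≤ R.trace.re := by
    have hP : (T * T - ((u : ℂ) ^ 2) • (1 : Matrix n n ℂ)).PosSemidef := by
      have h1 : (T * T - ((u : ℂ) ^ 2) • (1 : Matrix n n ℂ)) =
          (T - (u : ℂ) • (1 : Matrix n n ℂ)) ^ 2 +
            (2 * u : ℂ) • (T - (u : ℂ) • (1 : Matrix n n ℂ)) := by
        rw [pow_two (T - _), Matrix.sub_mul, Matrix.mul_sub, Matrix.mul_sub]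
        simp only [Matrix.smul_mul, Matrix.mul_smul, Matrix.one_mul, Matrix.mul_one, smul_sub,
          smul_smul]
        module
      rw [h1]
      exact (hT.pow 2).add (hT.smul (by exact_mod_cast (by positivity : (0 : ℝ) ≤ 2 * u)))
    have := trace_mul_re_nonneg hS hP
    rw [Matrix.mul_sub, trace_sub, ← Matrix.mul_assoc, trace_mul_comm, ← Matrix.mul_assoc, hTST,
      Matrix.mul_smul, Matrix.mul_one, trace_smul, ← Complex.ofReal_pow] at this
    simp only [smul_eq_mul, Complex.sub_re, Complex.re_ofReal_mul] at this
    linarith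
  rw [hdet]
  gcongr
  refine (det_one_add_re_le_exp_trace hS).trans (Real.exp_le_exp.mpr ?_)
  rw [inv_pow, ← div_eq_inv_mul, le_div_iff₀ (by positivity)]
  linarith

/-- One halving step for the Laplace functional `det (1 + h K)` of a kernel `0 ≤ K ≤ 1`. -/
theorem det_one_add_diagonal_mul_re_le {K : Matrix n n ℂ} (hK : K.PosSemidef)
    (hK1 : (1 - K).PosSemidef) {u : ℝ} (hu : 0 < u) (hu1 : u ≤ 1) {a : n → ℝ}
    (ha : ∀ i, u ≤ 1 + a i) :
    (1 + diagonal (fun i => (((1 + a i) ^ 2 - 1 : ℝ) : ℂ)) * K).det.re ≤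
      (1 + diagonal (fun i => (a i : ℂ)) * K).det.re ^ 2 *
        Real.exp (u⁻¹ ^ 2 *
          (K * diagonal (fun i => (a i : ℂ)) * (1 - K) * diagonal (fun i => (a i : ℂ))).trace.re) := by
  obtain ⟨B, hBB, hB⟩ := exists_hermitian_sqrt hK
  set a' := diagonal (fun i => (a i : ℂ)) with ha'
  have haH : a'ᴴ = a' := by
    rw [ha', diagonal_conjTranspose]
    congr 1
    ext i
    simp
  have hsq : diagonal (fun i => (((1 + a i) ^ 2 - 1 : ℝ) : ℂ)) = a' + a' + a' * a' := by
    rw [ha', diagonal_mul_diagonal, diagonal_add, diagonal_add]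
    congr 1
    ext i
    push_cast
    ring
  have hdet : ∀ d : Matrix n n ℂ, (1 + d * K).det = (1 + B * d * B).det := fun d => by
    rw [hBB, ← Matrix.mul_assoc, det_one_add_mul_comm, Matrix.mul_assoc]
  rw [hdet, hdet, hsq]
  have hT : ((1 + B * a' * B) - (u : ℂ) • (1 : Matrix n n ℂ)).PosSemidef := by
    have h1 : (1 + B * a' * B) - (u : ℂ) • (1 : Matrix n n ℂ) =
        ((1 - u : ℝ) : ℂ) • (1 - K) + B * diagonal (fun i => ((a i + (1 - u) : ℝ) : ℂ)) * Bᴴ := by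
      have : diagonal (fun i => ((a i + (1 - u) : ℝ) : ℂ)) =
          a' + ((1 - u : ℝ) : ℂ) • (1 : Matrix n n ℂ) := by
        rw [ha', smul_one_eq_diagonal, diagonal_add]
        congr 1
        ext i
        push_cast
        ring
      rw [this, hB, Matrix.mul_add, Matrix.add_mul, Matrix.mul_smul, Matrix.smul_mul,
        Matrix.mul_one, ← hBB]
      push_cast
      module
    rw [h1]
    refine (hK1.smul (by exact_mod_cast (by linarith : (0 : ℝ) ≤ 1 - u))).add
      (PosSemidef.mul_mul_conjTranspose_same (PosSemidef.diagonal ?_) B)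
    intro i
    have := ha i
    exact Complex.zero_le_real.mpr (by linarith : (0 : ℝ) ≤ a i + (1 - u))
  have hR : (B * a' * (1 - K) * a' * B).PosSemidef := by
    have := hK1.mul_mul_conjTranspose_same (B * a')
    rwa [conjTranspose_mul, haH, hB, ← Matrix.mul_assoc] at this
  have key := det_sq_add_re_le hu hT hR
  have e1 : (1 + B * a' * B) * (1 + B * a' * B) + B * a' * (1 - K) * a' * B =
      1 + B * (a' + a' + a' * a') * B := by
    rw [hBB]
    noncomm_ring
  have e2 : (B * a' * (1 - K) * a' * B).trace = (K * a' * (1 - K) * a').trace := by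
    rw [trace_mul_comm, ← Matrix.mul_assoc, ← Matrix.mul_assoc, ← Matrix.mul_assoc, ← hBB]
  rwa [e1, e2] at key

end Matrices

section DPP

open Matrix ComplexOrder

variable {N : ℕ} {μ : Finset (Fin N) → ℝ} {K : Matrix (Fin N) (Fin N) ℂ}

theorem IsDPPLaw.sum_mul_prod_one_add (hμ : IsDPPLaw μ K) (h : Fin N → ℝ) :
    ((∑ S, μ S * ∏ i ∈ S, (1 + h i) : ℝ) : ℂ) = (1 + diagonal (fun i => (h i : ℂ)) * K).det := by
  rw [add_comm, det_add_one_eq_sum_principal_minors]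
  have hminor : ∀ A : Finset (Fin N),
      ((diagonal (fun i => (h i : ℂ)) * K).submatrix (fun i : A => (i : Fin N))
        (fun j : A => (j : Fin N))).det =
      ((∑ S, if A ⊆ S then μ S * ∏ i ∈ A, h i else 0 : ℝ) : ℂ) := fun A => by
    have : (diagonal (fun i => (h i : ℂ)) * K).submatrix (fun i : A => (i : Fin N))
        (fun j : A => (j : Fin N)) = diagonal (fun i : A => (h i : ℂ)) *
          K.submatrix (fun i : A => (i : Fin N)) (fun j : A => (j : Fin N)) := by
      ext i j
      simp [diagonal_mul]
    rw [this, det_mul, det_diagonal, ← hμ.2.2 A, ← Finset.sum_filter, ← Finset.sum_mul,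
      Finset.prod_coe_sort A (fun i => (h i : ℂ))]
    push_cast
    ring
  simp_rw [hminor]
  rw [← Complex.ofReal_sum, Finset.sum_comm]
  congr 1
  refine Finset.sum_congr rfl fun S _ => ?_
  rw [Finset.prod_one_add, Finset.mul_sum, ← Finset.sum_filter]
  refine Finset.sum_congr ?_ fun _ _ => rfl
  ext A
  simp

theorem IsDPPLaw.eigenvalue_mem_Icc_s6 (hμ : IsDPPLaw μ K) {r : ℝ} {v : Fin N → ℂ} (hv : v ≠ 0)
    (hr : K *ᵥ v = (r : ℂ) • v) : 0 ≤ r ∧ r ≤ 1 := by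
  by_contra hcon
  have hr0 : r ≠ 0 := by
    rintro rfl
    norm_num at hcon
  have hpos : 0 < 1 + -r⁻¹ := by
    rcases lt_or_ge r 0 with h | h
    · have := inv_lt_zero.mpr h
      linarith
    · have h1 : 1 < r := by
        by_contra h1
        exact hcon ⟨h, not_lt.mp h1⟩
      have := inv_lt_one_of_one_lt₀ h1
      linarith
  have hlap := hμ.sum_mul_prod_one_add (fun _ => -r⁻¹)
  have hdet : (1 + diagonal (fun _ : Fin N => ((-r⁻¹ : ℝ) : ℂ)) * K).det = 0 := by
    rw [← exists_mulVec_eq_zero_iff]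
    refine ⟨v, hv, ?_⟩
    rw [add_mulVec, one_mulVec, ← mulVec_mulVec, hr, ← smul_one_eq_diagonal, smul_mulVec,
      one_mulVec, smul_smul, ← Complex.ofReal_mul]
    simp [hr0]
  rw [hdet] at hlap
  have hsum : 0 < ∑ S, μ S * ∏ i ∈ S, (1 + -r⁻¹) := by
    have hne : ∃ S, 0 < μ S := by
      by_contra! hall
      have := hμ.2.1
      have := Finset.sum_nonpos (s := Finset.univ) fun S _ => hall S
      linarith
    obtain ⟨S, hS⟩ := hne
    exact Finset.sum_pos' (fun S _ => mul_nonneg (hμ.1 S) (Finset.prod_nonneg fun _ _ => hpos.le))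
      ⟨S, Finset.mem_univ S, mul_pos hS (Finset.prod_pos fun _ _ => hpos)⟩
  exact hsum.ne' (by exact_mod_cast hlap)

theorem IsDPPLaw.posSemidef_s6 (hμ : IsDPPLaw μ K) (hK : K.IsHermitian) : K.PosSemidef :=
  posSemidef_of_forall_eigenvalue_nonneg hK fun _ _ hv hr => (hμ.eigenvalue_mem_Icc_s6 hv hr).1

theorem IsDPPLaw.one_sub_posSemidef (hμ : IsDPPLaw μ K) (hK : K.IsHermitian) :
    (1 - K).PosSemidef := by
  refine posSemidef_of_forall_eigenvalue_nonneg (isHermitian_one.sub hK) fun r v hv hr => ?_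
  have : K *ᵥ v = ((1 - r : ℝ) : ℂ) • v := by
    rw [sub_mulVec, one_mulVec] at hr
    rw [Complex.ofReal_sub, sub_smul, ← hr]
    simp
  linarith [(hμ.eigenvalue_mem_Icc_s6 hv this).2]

theorem IsDPPLaw.sum_ite_mem (hμ : IsDPPLaw μ K) (i : Fin N) :
    (∑ S, if i ∈ S then μ S else 0) = (K i i).re := by
  have h := hμ.2.2 {i}
  rw [det_unique] at h
  have h' := congrArg Complex.re h
  simp only [Complex.ofReal_re, Finset.singleton_subset_iff, Finset.sum_filter] at h'
  rw [h']
  rfl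

theorem IsDPPLaw.sum_ite_mem_and_mem (hμ : IsDPPLaw μ K) (hK : K.IsHermitian) (i j : Fin N) :
    (∑ S, if i ∈ S ∧ j ∈ S then μ S else 0) =
      (K i i).re * (K j j).re + ((if i = j then (K i i).re else 0) - Complex.normSq (K i j)) := by
  have him : ∀ i, K i i = ((K i i).re : ℂ) := fun i =>
    (Complex.conj_eq_iff_re.mp (hK.apply i i)).symm
  by_cases hij : i = j
  · subst hij
    have : Complex.normSq (K i i) = (K i i).re * (K i i).re := by
      rw [him i, Complex.normSq_ofReal, Complex.ofReal_re]
    simp [hμ.sum_ite_mem, this]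
  · have h := hμ.2.2 {i, j}
    have hi : i ∈ ({i, j} : Finset (Fin N)) := by simp
    have hj : j ∈ ({i, j} : Finset (Fin N)) := by simp
    let e : Fin 2 → ({i, j} : Finset (Fin N)) := ![⟨i, hi⟩, ⟨j, hj⟩]
    have he : Function.Bijective e := by
      constructor
      · intro a b hab
        fin_cases a <;> fin_cases b <;> simp_all [e, Subtype.ext_iff, eq_comm]
      · rintro ⟨k, hk⟩
        rcases Finset.mem_insert.mp hk with rfl | hk'
        · exact ⟨0, rfl⟩
        · exact ⟨1, Subtype.ext (Finset.mem_singleton.mp hk').symm⟩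
    rw [← det_submatrix_equiv_self (Equiv.ofBijective e he), det_fin_two] at h
    simp only [submatrix_apply, Equiv.ofBijective_apply, e, Matrix.cons_val_zero,
      Matrix.cons_val_one] at h
    have hn : K i j * K j i = (Complex.normSq (K i j) : ℂ) := by
      rw [← hK.apply j i]
      exact Complex.mul_conj _
    rw [hn, him i, him j] at h
    have h' := congrArg Complex.re h
    simp only [Complex.ofReal_re, Complex.sub_re, Complex.re_ofReal_mul, Finset.sum_filter, Finset.insert_subset_iff, Finset.singleton_subset_iff] at h'
    rw [h', if_neg hij]
    ring

theorem statMean_sum (hμ : IsDPPLaw μ K) (g : Fin N → ℝ) :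
    statMean μ (fun T => ∑ i ∈ T, g i) = ∑ i, g i * (K i i).re := by
  have : ∀ S : Finset (Fin N), ∑ i ∈ S, g i = ∑ i, if i ∈ S then g i else 0 := fun S => by simp
  simp only [statMean, this, Finset.mul_sum]
  rw [Finset.sum_comm]
  refine Finset.sum_congr rfl fun i _ => ?_
  rw [← hμ.sum_ite_mem, Finset.mul_sum]
  refine Finset.sum_congr rfl fun S _ => ?_
  split_ifs <;> ring

theorem statVar_eq (hμ : IsDPPLaw μ K) (X : Finset (Fin N) → ℝ) :
    statVar μ X = statMean μ (fun T => X T ^ 2) - statMean μ X ^ 2 := by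
  have h : ∀ c : ℝ, ∑ T, μ T * (X T - c) ^ 2 =
      statMean μ (fun T => X T ^ 2) - 2 * c * statMean μ X + c ^ 2 := fun c => by
    have h1 := hμ.2.1
    have : c ^ 2 = ∑ T, μ T * c ^ 2 := by rw [← Finset.sum_mul, h1, one_mul]
    rw [this, statMean, statMean, Finset.mul_sum, ← Finset.sum_sub_distrib,
      ← Finset.sum_add_distrib]
    exact Finset.sum_congr rfl fun T _ => by ring
  rw [statVar, h]
  ring

theorem statVar_sum (hμ : IsDPPLaw μ K) (hK : K.IsHermitian) (g : Fin N → ℝ) :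
    statVar μ (fun T => ∑ i ∈ T, g i) =
      ∑ i, ∑ j, g i * g j * ((if i = j then (K i i).re else 0) - Complex.normSq (K i j)) := by
  rw [statVar_eq hμ, statMean_sum hμ, pow_two, Finset.sum_mul_sum]
  have h2 : statMean μ (fun T => (∑ i ∈ T, g i) ^ 2) =
      ∑ i, ∑ j, g i * g j * ∑ S, if i ∈ S ∧ j ∈ S then μ S else 0 := by
    have : ∀ S : Finset (Fin N), ∑ i ∈ S, g i = ∑ i, if i ∈ S then g i else 0 := fun S => by simp
    have hS : ∀ S, μ S * (∑ i ∈ S, g i) ^ 2 =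
        ∑ i, ∑ j, g i * g j * if i ∈ S ∧ j ∈ S then μ S else 0 := fun S => by
      rw [this, pow_two, Finset.sum_mul_sum, Finset.mul_sum]
      refine Finset.sum_congr rfl fun i _ => ?_
      rw [Finset.mul_sum]
      refine Finset.sum_congr rfl fun j _ => ?_
      by_cases hi : i ∈ S <;> by_cases hj : j ∈ S <;> simp [hi, hj, mul_comm]
    simp only [statMean, hS, Finset.mul_sum]
    rw [Finset.sum_comm]
    exact Finset.sum_congr rfl fun i _ => Finset.sum_comm
  rw [h2, ← Finset.sum_sub_distrib]
  refine Finset.sum_congr rfl fun i _ => ?_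
  rw [← Finset.sum_sub_distrib]
  refine Finset.sum_congr rfl fun j _ => ?_
  rw [hμ.sum_ite_mem_and_mem hK]
  ring

theorem trace_eq_statVar_sum (hμ : IsDPPLaw μ K) (hK : K.IsHermitian) (g : Fin N → ℝ) :
    (K * diagonal (fun i => (g i : ℂ)) * (1 - K) * diagonal (fun i => (g i : ℂ))).trace.re =
      statVar μ (fun T => ∑ i ∈ T, g i) := by
  rw [statVar_sum hμ hK, trace, Complex.re_sum]
  refine Finset.sum_congr rfl fun i _ => ?_
  rw [diag_apply, mul_diagonal, mul_apply, Finset.sum_mul, Complex.re_sum]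
  refine Finset.sum_congr rfl fun j _ => ?_
  rw [mul_diagonal, Matrix.sub_apply, Matrix.one_apply]
  have hn : K i j * K j i = (Complex.normSq (K i j) : ℂ) := by
    rw [← hK.apply j i]
    exact Complex.mul_conj _
  have : K i j * (g j : ℂ) * ((if j = i then 1 else 0) - K j i) * (g i : ℂ) =
      ((g i * g j : ℝ) : ℂ) * ((if i = j then K i i else 0) - K i j * K j i) := by
    by_cases hij : i = j
    · subst hij
      simp
      ring
    · simp [hij, Ne.symm hij]
      ring
  rw [this, hn, Complex.re_ofReal_mul, Complex.sub_re, Complex.ofReal_re]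
  split_ifs <;> simp

theorem sum_normSq_le_diag (hμ : IsDPPLaw μ K) (hK : K.IsHermitian) (i : Fin N) :
    ∑ j, Complex.normSq (K i j) ≤ (K i i).re := by
  have hP : (K * (1 - K)).PosSemidef := by
    obtain ⟨B, hBB, hB⟩ := exists_hermitian_sqrt (hμ.posSemidef_s6 hK)
    have := (hμ.one_sub_posSemidef hK).mul_mul_conjTranspose_same B
    have e : K * (1 - K) = B * (1 - K) * Bᴴ := by
      rw [hB, hBB]
      noncomm_ring
    rwa [e]
  have h := (Complex.nonneg_iff.mp (hP.diag_nonneg (i := i))).1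
  rw [Matrix.mul_sub, Matrix.mul_one, Matrix.sub_apply, mul_apply, Complex.sub_re, Complex.re_sum] at h
  have : ∀ j, (K i j * K j i).re = Complex.normSq (K i j) := fun j => by
    rw [← hK.apply j i]
    exact congrArg Complex.re (Complex.mul_conj (K i j))
  simp only [this] at h
  linarith

/-- The variance of a linear statistic contracts under Lipschitz maps vanishing at `0`. -/
theorem statVar_sum_le_of_lipschitz (hμ : IsDPPLaw μ K) (hK : K.IsHermitian) {a g : Fin N → ℝ}
    {L : ℝ} (h0 : ∀ i, a i ^ 2 ≤ L * g i ^ 2)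
    (h1 : ∀ i j, (a i - a j) ^ 2 ≤ L * (g i - g j) ^ 2) :
    statVar μ (fun T => ∑ i ∈ T, a i) ≤ L * statVar μ (fun T => ∑ i ∈ T, g i) := by
  have hsymm : ∀ i j, Complex.normSq (K i j) = Complex.normSq (K j i) := fun i j => by
    rw [← hK.apply i j]
    exact Complex.normSq_conj _
  have hform : ∀ f : Fin N → ℝ, statVar μ (fun T => ∑ i ∈ T, f i) =
      ∑ i, f i ^ 2 * ((K i i).re - ∑ j, Complex.normSq (K i j)) +
        2⁻¹ * ∑ i, ∑ j, (f i - f j) ^ 2 * Complex.normSq (K i j) := fun f => by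
    rw [statVar_sum hμ hK]
    have e1 : ∑ i, ∑ j, f j ^ 2 * Complex.normSq (K i j) =
        ∑ i, ∑ j, f i ^ 2 * Complex.normSq (K i j) := by
      rw [Finset.sum_comm]
      exact Finset.sum_congr rfl fun i _ => Finset.sum_congr rfl fun j _ => by rw [hsymm]
    have e2 : ∑ i, ∑ j, (f i - f j) ^ 2 * Complex.normSq (K i j) =
        2 * ∑ i, ∑ j, f i ^ 2 * Complex.normSq (K i j) -
          2 * ∑ i, ∑ j, f i * f j * Complex.normSq (K i j) := by
      have : ∑ i, ∑ j, (f i - f j) ^ 2 * Complex.normSq (K i j) =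
          ∑ i, ∑ j, f i ^ 2 * Complex.normSq (K i j) +
          ∑ i, ∑ j, f j ^ 2 * Complex.normSq (K i j) -
          2 * ∑ i, ∑ j, f i * f j * Complex.normSq (K i j) := by
        simp only [Finset.mul_sum, ← Finset.sum_add_distrib, ← Finset.sum_sub_distrib]
        exact Finset.sum_congr rfl fun i _ => Finset.sum_congr rfl fun j _ => by ring
      rw [this, e1]
      ring
    rw [e2]
    simp only [mul_sub, Finset.sum_sub_distrib, mul_ite, mul_zero, Finset.sum_ite_eq,
      Finset.mem_univ, if_true, Finset.mul_sum]
    simp only [← Finset.mul_sum]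
    have : ∑ i, f i * f i * (K i i).re = ∑ i, f i ^ 2 * (K i i).re :=
      Finset.sum_congr rfl fun i _ => by ring
    rw [this]
    ring
  rw [hform, hform, mul_add, mul_left_comm L]
  refine add_le_add ?_ (mul_le_mul_of_nonneg_left ?_ (by norm_num))
  · rw [Finset.mul_sum]
    refine Finset.sum_le_sum fun i _ => ?_
    rw [← mul_assoc]
    exact mul_le_mul_of_nonneg_right (h0 i) (sub_nonneg.mpr (sum_normSq_le_diag hμ hK i))
  · simp only [Finset.mul_sum]
    refine Finset.sum_le_sum fun i _ => Finset.sum_le_sum fun j _ => ?_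
    rw [← mul_assoc]
    exact mul_le_mul_of_nonneg_right (h1 i j) (Complex.normSq_nonneg _)

end DPP

section Concentration

open Matrix Filter Topology

theorem sq_exp_sub_exp_le {x y b : ℝ} (hx : x ≤ b) (hy : y ≤ b) :
    (Real.exp x - Real.exp y) ^ 2 ≤ Real.exp (2 * b) * (x - y) ^ 2 := by
  have key : ∀ {x y : ℝ}, y ≤ x → x ≤ b →
      (Real.exp x - Real.exp y) ^ 2 ≤ Real.exp (2 * b) * (x - y) ^ 2 := by
    intro x y hyx hxb
    have h1 : Real.exp x - Real.exp y ≤ Real.exp b * (x - y) := by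
      have h2 : Real.exp y = Real.exp x * Real.exp (y - x) := by
        rw [← Real.exp_add]
        ring_nf
      have h3 : Real.exp x - Real.exp y ≤ Real.exp x * (x - y) := by
        rw [h2]
        nlinarith [Real.add_one_le_exp (y - x), Real.exp_pos x]
      exact h3.trans (mul_le_mul_of_nonneg_right (Real.exp_le_exp.mpr hxb) (sub_nonneg.mpr hyx))
    have h0 : 0 ≤ Real.exp x - Real.exp y := sub_nonneg.mpr (Real.exp_le_exp.mpr hyx)
    calc (Real.exp x - Real.exp y) ^ 2 ≤ (Real.exp b * (x - y)) ^ 2 := pow_le_pow_left₀ h0 h1 2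
      _ = Real.exp (2 * b) * (x - y) ^ 2 := by
        rw [mul_pow, ← Real.exp_nat_mul]
        norm_num
  rcases le_total y x with h | h
  · exact key h hx
  · have := key h hy
    rwa [← neg_sub x y, ← neg_sub (Real.exp x), neg_sq, neg_sq] at this

variable {N : ℕ} {μ : Finset (Fin N) → ℝ} {K : Matrix (Fin N) (Fin N) ℂ}

theorem statMean_const_mul (c : ℝ) (X : Finset (Fin N) → ℝ) :
    statMean μ (fun T => c * X T) = c * statMean μ X := by
  simp only [statMean, Finset.mul_sum]
  exact Finset.sum_congr rfl fun _ _ => by ring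

theorem statVar_const_mul (c : ℝ) (X : Finset (Fin N) → ℝ) :
    statVar μ (fun T => c * X T) = c ^ 2 * statVar μ X := by
  simp only [statVar, statMean_const_mul, Finset.mul_sum]
  exact Finset.sum_congr rfl fun _ _ => by ring

theorem statVar_nonneg (h : ∀ S, 0 ≤ μ S) (X : Finset (Fin N) → ℝ) : 0 ≤ statVar μ X :=
  Finset.sum_nonneg fun T _ => mul_nonneg (h T) (sq_nonneg _)

/-- Bound on the exponential moment of a linear statistic in terms of that of half of it. -/
theorem statMean_exp_sum_le_sq (hμ : IsDPPLaw μ K) (hK : K.IsHermitian) {g : Fin N → ℝ}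
    (hg : ∀ i, |g i| ≤ 1 / 3) :
    statMean μ (fun T => Real.exp (∑ i ∈ T, g i)) ≤
      statMean μ (fun T => Real.exp (2⁻¹ * ∑ i ∈ T, g i)) ^ 2 *
        Real.exp (2⁻¹ * statVar μ (fun T => ∑ i ∈ T, g i)) := by
  set a : Fin N → ℝ := fun i => Real.exp (2⁻¹ * g i) - 1 with ha
  have hmean : ∀ h : Fin N → ℝ, statMean μ (fun T => ∏ i ∈ T, (1 + h i)) =
      (1 + diagonal (fun i => (h i : ℂ)) * K).det.re := fun h => by
    rw [← hμ.sum_mul_prod_one_add, Complex.ofReal_re, statMean]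
  have e1 : statMean μ (fun T => Real.exp (∑ i ∈ T, g i)) =
      (1 + diagonal (fun i => (((1 + a i) ^ 2 - 1 : ℝ) : ℂ)) * K).det.re := by
    rw [← hmean]
    congr 1
    ext T
    rw [Real.exp_sum]
    refine Finset.prod_congr rfl fun i _ => ?_
    simp only [ha, add_sub_cancel]
    rw [← Real.exp_nat_mul]
    congr 1
    push_cast
    ring
  have e2 : statMean μ (fun T => Real.exp (2⁻¹ * ∑ i ∈ T, g i)) =
      (1 + diagonal (fun i => (a i : ℂ)) * K).det.re := by
    rw [← hmean]
    congr 1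
    ext T
    rw [Finset.mul_sum, Real.exp_sum]
    exact Finset.prod_congr rfl fun i _ => by simp [ha]
  have hg' : ∀ i, 2⁻¹ * g i ≤ 1 / 6 := fun i => by linarith [le_abs_self (g i), hg i]
  have hvar : statVar μ (fun T => ∑ i ∈ T, a i) ≤
      (Real.exp (1 / 3) / 4) * statVar μ (fun T => ∑ i ∈ T, g i) := by
    refine statVar_sum_le_of_lipschitz hμ hK (fun i => ?_) fun i j => ?_
    · have := sq_exp_sub_exp_le (hg' i) (by norm_num : (0 : ℝ) ≤ 1 / 6)
      rw [Real.exp_zero] at this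
      refine this.trans (le_of_eq ?_)
      ring_nf
    · have := sq_exp_sub_exp_le (hg' i) (hg' j)
      simp only [ha, sub_sub_sub_cancel_right]
      refine this.trans (le_of_eq ?_)
      ring_nf
  have hstep := det_one_add_diagonal_mul_re_le (hμ.posSemidef_s6 hK) (hμ.one_sub_posSemidef hK)
    (Real.exp_pos (-(1 / 6))) (Real.exp_le_one_iff.mpr (by norm_num)) (a := a) fun i => by
      simp only [ha, add_sub_cancel]
      exact Real.exp_le_exp.mpr (by linarith [neg_abs_le (g i), hg i])
  rw [e1, e2]
  refine hstep.trans (mul_le_mul_of_nonneg_left (Real.exp_le_exp.mpr ?_) (sq_nonneg _))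
  rw [trace_eq_statVar_sum hμ hK, ← Real.exp_neg, neg_neg, ← Real.exp_nat_mul]
  have h2 : Real.exp (2 / 3) ≤ 2 := by
    rw [← Real.le_log_iff_exp_le two_pos]
    linarith [Real.log_two_gt_d9]
  have hexp : Real.exp (((2 : ℕ) : ℝ) * (1 / 6)) * Real.exp (1 / 3) = Real.exp (2 / 3) := by
    rw [← Real.exp_add]
    norm_num
  have hV := statVar_nonneg hμ.1 (fun T => ∑ i ∈ T, g i)
  calc _ ≤ Real.exp (((2 : ℕ) : ℝ) * (1 / 6)) *
        (Real.exp (1 / 3) / 4 * statVar μ (fun T => ∑ i ∈ T, g i)) := by gcongr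
    _ = Real.exp (2 / 3) / 4 * statVar μ (fun T => ∑ i ∈ T, g i) := by rw [← hexp]; ring
    _ ≤ _ := mul_le_mul_of_nonneg_right (by linarith) hV

theorem statMean_exp_sum_le_pow (hμ : IsDPPLaw μ K) (hK : K.IsHermitian) {g : Fin N → ℝ}
    (hg : ∀ i, |g i| ≤ 1 / 3) (n : ℕ) :
    statMean μ (fun T => Real.exp (∑ i ∈ T, g i)) ≤
      statMean μ (fun T => Real.exp (2⁻¹ ^ n * ∑ i ∈ T, g i)) ^ 2 ^ n *
        Real.exp ((1 - 2⁻¹ ^ n) * statVar μ (fun T => ∑ i ∈ T, g i)) := by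
  induction n with
  | zero => simp
  | succ n ih =>
    have hscale : ∀ i, |2⁻¹ ^ n * g i| ≤ 1 / 3 := fun i => by
      rw [abs_mul, abs_of_pos (by positivity : (0 : ℝ) < 2⁻¹ ^ n)]
      exact (mul_le_of_le_one_left (abs_nonneg _)
        (pow_le_one₀ (by norm_num) (by norm_num))).trans (hg i)
    have hstep := statMean_exp_sum_le_sq hμ hK hscale
    simp only [← Finset.mul_sum, ← mul_assoc, ← pow_succ', statVar_const_mul] at hstep
    refine ih.trans ?_
    have hnonneg : 0 ≤ statMean μ (fun T => Real.exp (2⁻¹ ^ n * ∑ i ∈ T, g i)) :=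
      Finset.sum_nonneg fun T _ => mul_nonneg (hμ.1 T) (Real.exp_pos _).le
    have hpow := pow_le_pow_left₀ hnonneg hstep (2 ^ n)
    refine (mul_le_mul_of_nonneg_right hpow (Real.exp_pos _).le).trans (le_of_eq ?_)
    rw [mul_pow, ← pow_mul, ← Real.exp_nat_mul, mul_assoc, ← Real.exp_add, ← pow_succ']
    congr 2
    have : (2 : ℝ) ^ n * 2⁻¹ ^ n = 1 := by rw [← mul_pow]; norm_num
    push_cast
    linear_combination (2⁻¹ * (2⁻¹ : ℝ) ^ n * statVar μ fun T => ∑ i ∈ T, g i) * this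

theorem statMean_exp_const_mul_le (h0 : ∀ S, 0 ≤ μ S) (h1 : ∑ S, μ S = 1)
    {X : Finset (Fin N) → ℝ} {s b : ℝ} (hX : ∀ T, |X T| ≤ b) (hs : 0 ≤ s) (hsb : s * b ≤ 1) :
    statMean μ (fun T => Real.exp (s * X T)) ≤ Real.exp (s * statMean μ X + s ^ 2 * b ^ 2) := by
  have hpt : ∀ T, Real.exp (s * X T) ≤ 1 + s * X T + s ^ 2 * b ^ 2 := fun T => by
    have habs : |s * X T| ≤ s * b := by
      rw [abs_mul, abs_of_nonneg hs]
      exact mul_le_mul_of_nonneg_left (hX T) hs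
    have := (abs_le.mp (Real.abs_exp_sub_one_sub_id_le (habs.trans hsb))).2
    have hsq : (s * X T) ^ 2 ≤ s ^ 2 * b ^ 2 := by
      rw [← mul_pow, ← sq_abs]
      exact pow_le_pow_left₀ (abs_nonneg _) habs 2
    linarith
  calc statMean μ (fun T => Real.exp (s * X T))
      ≤ ∑ T, μ T * (1 + s * X T + s ^ 2 * b ^ 2) :=
        Finset.sum_le_sum fun T _ => mul_le_mul_of_nonneg_left (hpt T) (h0 T)
    _ = (s * statMean μ X + s ^ 2 * b ^ 2) + 1 := by
        have e : s * statMean μ X + s ^ 2 * b ^ 2 + 1 =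
            s * statMean μ X + (s ^ 2 * b ^ 2 + 1) * ∑ T, μ T := by rw [h1]; ring
        rw [e, statMean, Finset.mul_sum, Finset.mul_sum, ← Finset.sum_add_distrib]
        exact Finset.sum_congr rfl fun _ _ => by ring
    _ ≤ _ := Real.add_one_le_exp _

/-- Subgaussian-type exponential moment bound for linear statistics of a DPP. -/
theorem statMean_exp_sum_le (hμ : IsDPPLaw μ K) (hK : K.IsHermitian) {g : Fin N → ℝ}
    (hg : ∀ i, |g i| ≤ 1 / 3) :
    statMean μ (fun T => Real.exp (∑ i ∈ T, g i)) ≤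
      Real.exp (statMean μ (fun T => ∑ i ∈ T, g i) + statVar μ (fun T => ∑ i ∈ T, g i)) := by
  set X : Finset (Fin N) → ℝ := fun T => ∑ i ∈ T, g i with hXdef
  set b : ℝ := ∑ i, |g i|
  have hX : ∀ T, |X T| ≤ b := fun T => (Finset.abs_sum_le_sum_abs _ _).trans
    (Finset.sum_le_univ_sum_of_nonneg fun _ => abs_nonneg _)
  have hs : Tendsto (fun n : ℕ => (2⁻¹ : ℝ) ^ n) atTop (𝓝 0) :=
    tendsto_pow_atTop_nhds_zero_of_lt_one (by norm_num) (by norm_num)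
  have hlim : Tendsto (fun n : ℕ => Real.exp (statMean μ X + 2⁻¹ ^ n * b ^ 2 +
      (1 - 2⁻¹ ^ n) * statVar μ X)) atTop (𝓝 (Real.exp (statMean μ X + statVar μ X))) := by
    refine (Real.continuous_exp.tendsto _).comp ?_
    have := ((hs.mul_const (b ^ 2)).const_add (statMean μ X)).add
      ((hs.const_sub 1).mul_const (statVar μ X))
    simpa using this
  have hsb : ∀ᶠ n : ℕ in atTop, (2⁻¹ : ℝ) ^ n * b ≤ 1 := by
    have := hs.mul_const b
    rw [zero_mul] at this
    exact this.eventually_le_const one_pos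
  refine ge_of_tendsto hlim ?_
  filter_upwards [hsb] with n hn
  refine (statMean_exp_sum_le_pow hμ hK hg n).trans ?_
  have h1 := statMean_exp_const_mul_le hμ.1 hμ.2.1 hX (by positivity : (0 : ℝ) ≤ 2⁻¹ ^ n) hn
  have hnonneg : 0 ≤ statMean μ (fun T => Real.exp (2⁻¹ ^ n * X T)) :=
    Finset.sum_nonneg fun T _ => mul_nonneg (hμ.1 T) (Real.exp_pos _).le
  refine (mul_le_mul_of_nonneg_right (pow_le_pow_left₀ hnonneg h1 (2 ^ n))
    (Real.exp_pos _).le).trans (le_of_eq ?_)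
  rw [← Real.exp_nat_mul, ← Real.exp_add]
  congr 1
  have : (2 : ℝ) ^ n * 2⁻¹ ^ n = 1 := by rw [← mul_pow]; norm_num
  push_cast
  linear_combination (statMean μ X + 2⁻¹ ^ n * b ^ 2) * this

/-- Chernoff bound for linear statistics of a DPP. -/
theorem sum_filter_le_abs_sub_statMean_le (hμ : IsDPPLaw μ K) (hK : K.IsHermitian)
    {g : Fin N → ℝ} {l V t : ℝ} (hl : 0 ≤ l) (hg : ∀ i, l * |g i| ≤ 1 / 3)
    (hV : statVar μ (fun T => ∑ i ∈ T, g i) ≤ V) :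
    ∑ T ∈ Finset.univ.filter (fun T : Finset (Fin N) =>
        t ≤ |∑ i ∈ T, g i - statMean μ (fun T => ∑ i ∈ T, g i)|), μ T ≤
      2 * Real.exp (l ^ 2 * V - l * t) := by
  set X : Finset (Fin N) → ℝ := fun T => ∑ i ∈ T, g i with hXdef
  have hmgf : ∀ c : ℝ, |c| = l →
      ∑ T, μ T * Real.exp (c * (X T - statMean μ X) - l * t) ≤ Real.exp (l ^ 2 * V - l * t) := by
    intro c hc
    have hcg : ∀ i, |c * g i| ≤ 1 / 3 := fun i => by rw [abs_mul, hc]; exact hg i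
    have h := statMean_exp_sum_le hμ hK hcg
    simp only [← Finset.mul_sum, statMean_const_mul, statVar_const_mul] at h
    have e : ∑ T, μ T * Real.exp (c * (X T - statMean μ X) - l * t) =
        statMean μ (fun T => Real.exp (c * X T)) * Real.exp (-(c * statMean μ X) - l * t) := by
      rw [show statMean μ (fun T => Real.exp (c * X T)) = ∑ T, μ T * Real.exp (c * X T) from rfl,
        Finset.sum_mul]
      refine Finset.sum_congr rfl fun T _ => ?_
      rw [mul_assoc, ← Real.exp_add]
      ring_nf
    rw [e]
    refine (mul_le_mul_of_nonneg_right h (Real.exp_pos _).le).trans ?_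
    rw [← Real.exp_add]
    refine Real.exp_le_exp.mpr ?_
    have hc2 : c ^ 2 = l ^ 2 := by rw [← sq_abs, hc]
    have := mul_le_mul_of_nonneg_left hV (sq_nonneg l)
    rw [hc2]
    linarith
  have h1 := hmgf l (abs_of_nonneg hl)
  have h2 := hmgf (-l) (by rw [abs_neg, abs_of_nonneg hl])
  rw [Finset.sum_filter, two_mul]
  refine le_trans ?_ (add_le_add h1 h2)
  rw [← Finset.sum_add_distrib]
  refine Finset.sum_le_sum fun T _ => ?_
  rw [← mul_add]
  split_ifs with hT
  · refine le_mul_of_one_le_right (hμ.1 T) ?_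
    rcases le_abs.mp hT with h | h
    · have : 1 ≤ Real.exp (l * (X T - statMean μ X) - l * t) :=
        Real.one_le_exp (sub_nonneg.mpr (mul_le_mul_of_nonneg_left h hl))
      linarith [Real.exp_pos (-l * (X T - statMean μ X) - l * t)]
    · have : 1 ≤ Real.exp (-l * (X T - statMean μ X) - l * t) :=
        Real.one_le_exp (by linarith [mul_le_mul_of_nonneg_left h hl])
      linarith [Real.exp_pos (l * (X T - statMean μ X) - l * t)]
  · exact mul_nonneg (hμ.1 T) (add_pos (Real.exp_pos _) (Real.exp_pos _)).le

end Concentration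

section Net

theorem exists_finset_half_net_unitBall (E : Type*) [NormedAddCommGroup E] [NormedSpace ℝ E]
    [FiniteDimensional ℝ E] :
    ∃ s : Finset E, s.card ≤ 5 ^ Module.finrank ℝ E ∧ (∀ y ∈ s, ‖y‖ ≤ 1) ∧
      ∀ x : E, ‖x‖ ≤ 1 → ∃ y ∈ s, ‖x - y‖ ≤ 1 / 2 := by
  let P : Finset E → Prop := fun s =>
    (∀ y ∈ s, ‖y‖ ≤ 1) ∧ ∀ y ∈ s, ∀ z ∈ s, y ≠ z → 1 / 2 ≤ ‖y - z‖
  have hcard : ∀ s, P s → s.card ≤ 5 ^ Module.finrank ℝ E := fun s hs => by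
    have hinj : Function.Injective fun y : E => (2 : ℝ) • y := smul_right_injective E two_ne_zero
    rw [← Finset.card_image_of_injective s hinj]
    refine Besicovitch.card_le_of_separated _ ?_ ?_
    · simp only [Finset.mem_image]
      rintro _ ⟨y, hy, rfl⟩
      rw [norm_smul, Real.norm_two]
      linarith [hs.1 y hy]
    · simp only [Finset.mem_image]
      rintro _ ⟨y, hy, rfl⟩ _ ⟨z, hz, rfl⟩ hne
      rw [← smul_sub, norm_smul, Real.norm_two]
      linarith [hs.2 y hy z hz fun h => hne (by rw [h])]
  let C : Set ℕ := {k | ∃ s, P s ∧ s.card = k}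
  have hne : C.Nonempty := ⟨0, ∅, by simp [P], rfl⟩
  have hbdd : BddAbove C := ⟨_, by rintro _ ⟨s, hs, rfl⟩; exact hcard s hs⟩
  obtain ⟨s, hs, hmax⟩ := Nat.sSup_mem hne hbdd
  refine ⟨s, hcard s hs, hs.1, fun x hx => ?_⟩
  by_contra! hfar
  have hxs : x ∉ s := fun hxs => by
    have := hfar x hxs
    rw [sub_self, norm_zero] at this
    norm_num at this
  have hP : P (insert x s) := by
    refine ⟨fun y hy => ?_, fun y hy z hz hyz => ?_⟩
    · rcases Finset.mem_insert.mp hy with rfl | hy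
      exacts [hx, hs.1 y hy]
    · rcases Finset.mem_insert.mp hy with rfl | hy' <;>
        rcases Finset.mem_insert.mp hz with rfl | hz'
      · exact absurd rfl hyz
      · exact (hfar z hz').le
      · rw [norm_sub_rev]
        exact (hfar y hy').le
      · exact hs.2 y hy' z hz' hyz
  have := le_csSup hbdd ⟨_, hP, rfl⟩
  rw [Finset.card_insert_of_notMem hxs, hmax] at this
  omega

theorem abs_lt_two_mul_of_half_net {E : Type*} [NormedAddCommGroup E] [NormedSpace ℝ E]
    [FiniteDimensional ℝ E] {s : Finset E} (hs : ∀ x : E, ‖x‖ ≤ 1 → ∃ y ∈ s, ‖x - y‖ ≤ 1 / 2)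
    (φ : E →ₗ[ℝ] ℝ) {t : ℝ} (ht : ∀ y ∈ s, |φ y| < t) {x : E} (hx : ‖x‖ ≤ 1) :
    |φ x| < 2 * t := by
  have hne : s.Nonempty := by
    obtain ⟨y, hy, -⟩ := hs x hx
    exact ⟨y, hy⟩
  obtain ⟨y₀, hy₀, hmax⟩ := s.exists_max_image (fun y => |φ y|) hne
  set L : E →L[ℝ] ℝ := LinearMap.toContinuousLinearMap φ
  have hL : ∀ z, φ z = L z := fun z => rfl
  have hbound : ∀ z : E, ‖z‖ ≤ 1 → |φ z| ≤ |φ y₀| + ‖L‖ / 2 := fun z hz => by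
    obtain ⟨y, hy, hzy⟩ := hs z hz
    have h1 : |φ (z - y)| ≤ ‖L‖ * ‖z - y‖ := L.le_opNorm (z - y)
    have h2 : ‖L‖ * ‖z - y‖ ≤ ‖L‖ * (1 / 2) := mul_le_mul_of_nonneg_left hzy (norm_nonneg _)
    have h3 : |φ z| ≤ |φ y| + |φ (z - y)| := by
      have : φ z = φ y + φ (z - y) := by rw [map_sub]; ring
      rw [this]
      exact abs_add_le _ _
    linarith [hmax y hy]
  have hnorm : ‖L‖ ≤ |φ y₀| + ‖L‖ / 2 :=
    L.opNorm_le_of_unit_norm (by positivity) fun z hz => hbound z hz.le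
  linarith [hbound x hx, ht y₀ hy₀]

theorem sum_biUnion_le_sum {ι β : Type*} [DecidableEq β] {g : β → ℝ} (hg : ∀ b, 0 ≤ g b)
    (s : Finset ι) (u : ι → Finset β) : ∑ b ∈ s.biUnion u, g b ≤ ∑ i ∈ s, ∑ b ∈ u i, g b := by
  induction s using Finset.induction_on with
  | empty => simp
  | insert i s hi ih =>
    rw [Finset.biUnion_insert, Finset.sum_insert hi]
    linarith [Finset.sum_union_inter (s₁ := u i) (s₂ := s.biUnion u) (f := g),
      Finset.sum_nonneg fun b (_ : b ∈ u i ∩ s.biUnion u) => hg b]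

end Net

section Coreset

variable {N : ℕ} {μ : Finset (Fin N) → ℝ} {K : Matrix (Fin N) (Fin N) ℂ}

/-- The centered rescaled coreset estimator at a fixed sample, as a functional of `f`. -/
noncomputable def coresetDeviation (K : Matrix (Fin N) (Fin N) ℂ) (T : Finset (Fin N)) :
    (Fin N → ℝ) →ₗ[ℝ] ℝ where
  toFun f := (N : ℝ)⁻¹ * coresetEstimator K f T - (N : ℝ)⁻¹ * ∑ i, f i
  map_add' f g := by
    simp only [coresetEstimator, Pi.add_apply, add_div, Finset.sum_add_distrib]
    ring
  map_smul' r f := by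
    simp only [coresetEstimator, Pi.smul_apply, smul_eq_mul, mul_div_assoc, ← Finset.mul_sum,
      RingHom.id_apply]
    ring

theorem inv_mul_coresetEstimator (f : Fin N → ℝ) :
    (fun T => (N : ℝ)⁻¹ * coresetEstimator K f T) =
      fun T => ∑ i ∈ T, (N : ℝ)⁻¹ * (f i / (K i i).re) := by
  ext T
  rw [coresetEstimator, Finset.mul_sum]

theorem statMean_inv_mul_coresetEstimator (hμ : IsDPPLaw μ K) (hpos : ∀ i, 0 < (K i i).re)
    (f : Fin N → ℝ) :
    statMean μ (fun T => (N : ℝ)⁻¹ * coresetEstimator K f T) = (N : ℝ)⁻¹ * ∑ i, f i := by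
  rw [inv_mul_coresetEstimator, statMean_sum hμ, Finset.mul_sum]
  refine Finset.sum_congr rfl fun i _ => ?_
  rw [mul_assoc, div_mul_cancel₀ _ (hpos i).ne']

theorem statVar_inv_mul_coresetEstimator (hμ : IsDPPLaw μ K) (hpos : ∀ i, 0 < (K i i).re)
    (f : Fin N → ℝ) :
    statVar μ (fun T => (N : ℝ)⁻¹ * coresetEstimator K f T) =
      ∑ T, μ T * coresetDeviation K T f ^ 2 := by
  rw [statVar, statMean_inv_mul_coresetEstimator hμ hpos]
  rfl

/-- Combines the rescaled sup norm of `f` with the rescaled standard deviation of its estimator. -/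
noncomputable def coresetEmbedding (μ : Finset (Fin N) → ℝ) (K : Matrix (Fin N) (Fin N) ℂ)
    (M V : ℝ) : (Fin N → ℝ) →ₗ[ℝ] (Fin N → ℝ) × EuclideanSpace ℝ (Finset (Fin N)) :=
  LinearMap.prod (M⁻¹ • LinearMap.id)
    ((WithLp.linearEquiv 2 ℝ (Finset (Fin N) → ℝ)).symm.toLinearMap ∘ₗ
      LinearMap.pi fun T => √(μ T / V) • coresetDeviation K T)

theorem norm_coresetEmbedding_le_one_iff (hμ : IsDPPLaw μ K) (hpos : ∀ i, 0 < (K i i).re)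
    {M V : ℝ} (hM : 0 < M) (hV : 0 < V) (f : Fin N → ℝ) :
    ‖coresetEmbedding μ K M V f‖ ≤ 1 ↔ (∀ i, |f i| ≤ M) ∧
      statVar μ (fun T => (N : ℝ)⁻¹ * coresetEstimator K f T) ≤ V := by
  rw [norm_prod_le_iff]
  refine and_congr ?_ ?_
  · rw [pi_norm_le_iff_of_nonneg zero_le_one]
    refine forall_congr' fun i => ?_
    change ‖M⁻¹ * f i‖ ≤ 1 ↔ _
    rw [norm_mul, Real.norm_of_nonneg (inv_nonneg.mpr hM.le), Real.norm_eq_abs,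
      inv_mul_le_one₀ hM]
  · rw [← sq_le_one_iff₀ (norm_nonneg _), EuclideanSpace.norm_sq_eq,
      statVar_inv_mul_coresetEstimator hμ hpos, ← div_le_one hV, Finset.sum_div]
    refine iff_of_eq (congrArg (· ≤ 1) (Finset.sum_congr rfl fun T _ => ?_))
    change ‖√(μ T / V) * coresetDeviation K T f‖ ^ 2 = _
    rw [Real.norm_eq_abs, sq_abs, mul_pow, Real.sq_sqrt (div_nonneg (hμ.1 T) hV.le)]
    ring

theorem coresetEmbedding_injective {M : ℝ} (hM : 0 < M) (V : ℝ) :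
    Function.Injective (coresetEmbedding μ K M V) := by
  intro f g hfg
  have h : M⁻¹ • f = M⁻¹ • g := congrArg Prod.fst hfg
  exact smul_right_injective _ (inv_ne_zero hM.ne') h

/-- The tail bound for the coreset estimator of one function. -/
theorem sum_filter_le_abs_coresetDeviation_le (hμ : IsDPPLaw μ K) (hK : K.IsHermitian)
    (hpos : ∀ i, 0 < (K i i).re) {f : Fin N → ℝ} {V t κ M : ℝ} (hV : 0 < V) (ht : 0 ≤ t)
    (hκ : 0 < κ) (hM : 0 < M) (hKκ : ∀ i, κ / N ≤ (K i i).re) (hf : ∀ i, |f i| ≤ M)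
    (hfV : statVar μ (fun T => (N : ℝ)⁻¹ * coresetEstimator K f T) ≤ V)
    (htM : t ≤ 2 * κ * V / (3 * M)) :
    ∑ T ∈ Finset.univ.filter (fun T : Finset (Fin N) => t ≤ |coresetDeviation K T f|), μ T ≤
      2 * Real.exp (-(t ^ 2 / (4 * V))) := by
  have hmean := statMean_inv_mul_coresetEstimator hμ hpos f
  rw [inv_mul_coresetEstimator] at hmean hfV
  have h := sum_filter_le_abs_sub_statMean_le (l := t / (2 * V)) (t := t) hμ hK (by positivity)
    (fun i => ?_) hfV
  · have hdev : ∀ T, coresetDeviation K T f =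
        ∑ i ∈ T, (N : ℝ)⁻¹ * (f i / (K i i).re) - (N : ℝ)⁻¹ * ∑ i, f i := fun T => by
      rw [← Finset.mul_sum]
      rfl
    simp only [hdev]
    rw [hmean] at h
    refine h.trans (le_of_eq ?_)
    congr 2
    field_simp
    ring
  · have hN : (0 : ℝ) < N := by exact_mod_cast i.pos
    have hκK : κ ≤ N * (K i i).re := by
      rw [mul_comm]
      exact (div_le_iff₀ hN).mp (hKκ i)
    have h1 : |(N : ℝ)⁻¹ * (f i / (K i i).re)| ≤ M / κ := by
      have e : (N : ℝ)⁻¹ * (f i / (K i i).re) = f i / (N * (K i i).re) := by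
        rw [div_mul_eq_div_div_swap, inv_mul_eq_div]
      rw [e, abs_div, abs_of_pos (mul_pos hN (hpos i))]
      exact div_le_div₀ hM.le (hf i) hκ hκK
    have h2 : t / (2 * V) ≤ κ / (3 * M) := by
      rw [div_le_iff₀ (by positivity)]
      refine htM.trans (le_of_eq ?_)
      ring
    refine (mul_le_mul h2 h1 (abs_nonneg _) (by positivity)).trans (le_of_eq ?_)
    field_simp

/-- Uniform tail bound over a class of bounded functions with finite-dimensional span. -/
theorem sum_filter_exists_le_abs_coresetDeviation_le (hμ : IsDPPLaw μ K) (hK : K.IsHermitian)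
    (hpos : ∀ i, 0 < (K i i).re) {F : Set (Fin N → ℝ)} {V t κ M : ℝ} (hV : 0 < V) (ht : 0 ≤ t)
    (hκ : 0 < κ) (hM : 0 < M) (hKκ : ∀ i, κ / N ≤ (K i i).re) (hF : ∀ f ∈ F, ∀ i, |f i| ≤ M)
    (hFV : ∀ f ∈ F, statVar μ (fun T => (N : ℝ)⁻¹ * coresetEstimator K f T) ≤ V)
    (htM : t ≤ 2 * κ * V / (3 * M)) :
    ∑ T ∈ Finset.univ.filter
        (fun T : Finset (Fin N) => ∃ f ∈ F, 2 * t ≤ |coresetDeviation K T f|), μ T ≤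
      5 ^ Module.finrank ℝ (Submodule.span ℝ F) * (2 * Real.exp (-(t ^ 2 / (4 * V)))) := by
  let e := Submodule.equivMapOfInjective (coresetEmbedding μ K M V)
    (coresetEmbedding_injective hM V) (Submodule.span ℝ F)
  have hnorm : ∀ f, ‖e f‖ ≤ 1 ↔ _ := fun f =>
    norm_coresetEmbedding_le_one_iff hμ hpos hM hV (f : Fin N → ℝ)
  obtain ⟨s, hcard, hs1, hs⟩ := exists_finset_half_net_unitBall
    (Submodule.map (coresetEmbedding μ K M V) (Submodule.span ℝ F))
  rw [← e.finrank_eq] at hcard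
  have hsub : Finset.univ.filter
      (fun T : Finset (Fin N) => ∃ f ∈ F, 2 * t ≤ |coresetDeviation K T f|) ⊆
      s.biUnion fun y => Finset.univ.filter
        (fun T : Finset (Fin N) => t ≤ |coresetDeviation K T (e.symm y : Fin N → ℝ)|) := by
    intro T hT
    obtain ⟨f, hf, hfT⟩ := (Finset.mem_filter.mp hT).2
    by_contra hcon
    simp only [Finset.mem_biUnion, Finset.mem_filter, Finset.mem_univ, true_and, not_exists,
      not_and, not_le] at hcon
    have := abs_lt_two_mul_of_half_net hs
      ((coresetDeviation K T ∘ₗ (Submodule.span ℝ F).subtype) ∘ₗ e.symm.toLinearMap)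
      hcon ((hnorm ⟨f, Submodule.subset_span hf⟩).mpr ⟨hF f hf, hFV f hf⟩)
    simp only [LinearMap.comp_apply, LinearEquiv.coe_coe, LinearEquiv.symm_apply_apply,
      Submodule.subtype_apply] at this
    linarith
  have hy : ∀ y ∈ s, ∑ T ∈ Finset.univ.filter
      (fun T : Finset (Fin N) => t ≤ |coresetDeviation K T (e.symm y : Fin N → ℝ)|), μ T ≤
      2 * Real.exp (-(t ^ 2 / (4 * V))) := fun y hy => by
    have h := (hnorm (e.symm y)).mp (by rw [e.apply_symm_apply]; exact hs1 y hy)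
    exact sum_filter_le_abs_coresetDeviation_le hμ hK hpos hV ht hκ hM hKκ h.1 h.2 htM
  calc _ ≤ ∑ T ∈ s.biUnion fun y => Finset.univ.filter
        (fun T : Finset (Fin N) => t ≤ |coresetDeviation K T (e.symm y : Fin N → ℝ)|), μ T :=
        Finset.sum_le_sum_of_subset_of_nonneg hsub fun T _ _ => hμ.1 T
    _ ≤ ∑ y ∈ s, ∑ T ∈ Finset.univ.filter
        (fun T : Finset (Fin N) => t ≤ |coresetDeviation K T (e.symm y : Fin N → ℝ)|), μ T :=
        sum_biUnion_le_sum hμ.1 _ _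
    _ ≤ s.card * (2 * Real.exp (-(t ^ 2 / (4 * V)))) := by
        rw [← nsmul_eq_mul]
        exact Finset.sum_le_card_nsmul _ _ _ hy
    _ ≤ _ := by
        refine mul_le_mul_of_nonneg_right ?_ (by positivity)
        exact_mod_cast hcard

end Coreset

/-- **PAC bound for DPP-based coresets, finite-dimensional function class**
(Tran et al., NeurIPS 2024). -/
theorem dpp_coreset_pac_finite_dim :
    ∃ A : ℝ, 0 < A ∧
      ∀ (N : ℕ) (K : Matrix (Fin N) (Fin N) ℂ), K.IsHermitian →
      ∀ μ : Finset (Fin N) → ℝ, IsDPPLaw μ K →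
      ∀ m : ℝ, m = statMean μ (fun T => (T.card : ℝ)) →
      ∀ ρ : ℝ, 0 < ρ → (∀ i, ρ * m / N ≤ (K i i).re) →
      ∀ (F : Set (Fin N → ℝ)) (D : ℕ),
        Module.finrank ℝ (Submodule.span ℝ F) = D →
      ∀ c : ℝ, 0 < c → (∀ f ∈ F, c ≤ |∑ x, f x| / N) →
      ∀ V : ℝ, (∀ f ∈ F, statVar μ (fun T => (N : ℝ)⁻¹ * coresetEstimator K f T) ≤ V) →
      ∀ ε : ℝ, 0 ≤ ε →
        ε ≤ 4 * A * ρ * m * V / (3 * c * ⨆ f : F, ⨆ x : Fin N, |(f : Fin N → ℝ) x|) →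
        (∑ T ∈ Finset.univ.filter (fun T : Finset (Fin N) =>
            ∃ f ∈ F, ε ≤ |coresetEstimator K f T / (∑ x, f x) - 1|), μ T)
          ≤ 2 * Real.exp (6 * D - c ^ 2 * ε ^ 2 / (16 * A * V)) := by
  refine ⟨1, one_pos, ?_⟩
  intro N K hK μ hμ m hm ρ hρ hKρ F D hD c hc hFc V hFV ε hε hεle
  rcases hε.eq_or_lt with rfl | hε
  · have hle := Finset.sum_le_sum_of_subset_of_nonneg (Finset.filter_subset (fun T : Finset (Fin N) =>
      ∃ f ∈ F, 0 ≤ |coresetEstimator K f T / (∑ x, f x) - 1|) Finset.univ) fun T _ _ => hμ.1 T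
    rw [hμ.2.1] at hle
    have : 1 ≤ Real.exp (6 * D - c ^ 2 * 0 ^ 2 / (16 * 1 * V)) := Real.one_le_exp (by simp)
    linarith
  rcases F.eq_empty_or_nonempty with rfl | ⟨f₀, hf₀⟩
  · simpa using (Real.exp_pos _).le
  set M := ⨆ f : F, ⨆ x : Fin N, |(f : Fin N → ℝ) x| with hMdef
  have hM0 : 0 ≤ M := Real.iSup_nonneg fun f => Real.iSup_nonneg fun x => abs_nonneg _
  have hV0 : 0 ≤ V := (statVar_nonneg hμ.1 _).trans (hFV f₀ hf₀)
  have hm0 : 0 ≤ m := hm ▸ Finset.sum_nonneg fun T _ => mul_nonneg (hμ.1 T) (Nat.cast_nonneg _)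
  have hεpos := hε.trans_le hεle
  have hM : 0 < M := hM0.lt_of_ne' fun h => by simp [h] at hεpos
  have hV : 0 < V := hV0.lt_of_ne' fun h => by simp [h] at hεpos
  have hmpos : 0 < m := hm0.lt_of_ne' fun h => by simp [h] at hεpos
  have hpos : ∀ i, 0 < (K i i).re := fun i => by
    have : (0 : ℝ) < N := by exact_mod_cast i.pos
    exact lt_of_lt_of_le (by positivity) (hKρ i)
  have hN : (0 : ℝ) < N := by
    refine (Nat.cast_nonneg N).lt_of_ne' fun h => ?_
    have := hFc f₀ hf₀
    rw [h, div_zero] at this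
    linarith
  have hFM : ∀ f ∈ F, ∀ i, |f i| ≤ M := fun f hf i => by
    have hbdd : BddAbove (Set.range fun f : F => ⨆ x : Fin N, |(f : Fin N → ℝ) x|) := by
      by_contra h
      exact hM.ne' (Real.iSup_of_not_bddAbove h)
    exact (le_ciSup (Set.finite_range fun x => |f x|).bddAbove i).trans (le_ciSup hbdd ⟨f, hf⟩)
  have htM : c * ε / 2 ≤ 2 * (ρ * m) * V / (3 * M) := by
    rw [le_div_iff₀ (by positivity)] at hεle ⊢
    linarith
  have hmain := sum_filter_exists_le_abs_coresetDeviation_le hμ hK hpos hV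
    (by positivity : 0 ≤ c * ε / 2) (mul_pos hρ hmpos) hM hKρ hFM hFV htM
  have hsub : Finset.univ.filter (fun T : Finset (Fin N) =>
      ∃ f ∈ F, ε ≤ |coresetEstimator K f T / (∑ x, f x) - 1|) ⊆
      Finset.univ.filter (fun T : Finset (Fin N) =>
        ∃ f ∈ F, 2 * (c * ε / 2) ≤ |coresetDeviation K T f|) := by
    intro T hT
    obtain ⟨f, hf, hfT⟩ := (Finset.mem_filter.mp hT).2
    refine Finset.mem_filter.mpr ⟨Finset.mem_univ T, f, hf, ?_⟩
    have hcf := hFc f hf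
    have hne : ∑ x, f x ≠ 0 := fun h => by
      rw [h, abs_zero, zero_div] at hcf
      linarith
    have hdev : coresetDeviation K T f =
        (∑ x, f x) / N * (coresetEstimator K f T / (∑ x, f x) - 1) := by
      change (N : ℝ)⁻¹ * coresetEstimator K f T - (N : ℝ)⁻¹ * ∑ i, f i = _
      field_simp
    rw [hdev, abs_mul, abs_div, abs_of_pos hN, mul_div_cancel₀ _ two_ne_zero]
    exact mul_le_mul hcf hfT hε.le (hc.le.trans hcf)
  refine (Finset.sum_le_sum_of_subset_of_nonneg hsub fun T _ _ => hμ.1 T).trans (hmain.trans ?_)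
  have h5 : (5 : ℝ) ^ D ≤ Real.exp (6 * D) := by
    rw [mul_comm, Real.exp_nat_mul]
    exact pow_le_pow_left₀ (by norm_num) (by linarith [Real.add_one_le_exp (6 : ℝ)]) D
  rw [hD, sub_eq_add_neg, Real.exp_add, mul_left_comm]
  have hexp : (c * ε / 2) ^ 2 / (4 * V) = c ^ 2 * ε ^ 2 / (16 * 1 * V) := by
    field_simp
    norm_num
  rw [hexp]
  gcongr
end
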